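/- arXiv:1411.0697 — 2 statements merged into one kernel-verified Lean document; each statement's English description precedes it below -/
import Mathlib

section
/- Let 1<p₁,p₂<∞, 0<α<2n, α/n < 1/p₁ + 1/p₂ < 2, and 1/q = 1/p₁ + 1/p₂ − α/n with 1<q<∞ (so that 2n − α − n/q > 0). Let b be a real-valued BMO function with ‖b‖_{BMO} = 1, Q_j a cube with center y_j and side length d_j, and let f_j, g_j be the associated test functions. Then there is a constant C independent of Q_j and b such that for every γ̃₁ > 16, (∫_{|x−y_j| > γ̃₁ d_j} |(b(x) − b_{Q_j}) I_α(f_j,g_j)(x)|^q dx)^{1/q} ≤ C γ̃₁^{−(2n − α − n/q + 1/2)}. -/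
open MeasureTheory Set Filter
open scoped ENNReal BigOperators Topology

noncomputable section

/-- Euclidean space `ℝⁿ`. -/
abbrev Rn (n : ℕ) : Type := EuclideanSpace ℝ (Fin n)

/-- The closed axis-parallel cube with center `c` and side length `d`. -/
def cube (n : ℕ) (c : Rn n) (d : ℝ) : Set (Rn n) :=
  {x | ∀ i : Fin n, |x i - c i| ≤ d / 2}

/-- The average `b_Q` of `b` over the cube with center `c` and side length `d`. -/
def cubeAvg (n : ℕ) (b : Rn n → ℝ) (c : Rn n) (d : ℝ) : ℝ :=
  ⨍ x in cube n c d, b x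

/-- The mean oscillation `⨍_Q |b - b_Q|` of `b` over a cube. -/
def osc (n : ℕ) (b : Rn n → ℝ) (c : Rn n) (d : ℝ) : ℝ :=
  ⨍ x in cube n c d, |b x - cubeAvg n b c d|

/-- The BMO seminorm: supremum of mean oscillations over all axis-parallel cubes. -/
def bmoNorm (n : ℕ) (b : Rn n → ℝ) : ℝ :=
  ⨆ cd : Rn n × {d : ℝ // 0 < d}, osc n b cd.1 cd.2.1

/-- `b ∈ CMO`: `b` belongs to the closure of `C_c^∞` in the BMO seminorm. -/
def MemCMO (n : ℕ) (b : Rn n → ℝ) : Prop :=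
  ∀ ε : ℝ, 0 < ε → ∃ φ : Rn n → ℝ, ContDiff ℝ (⊤ : ℕ∞) φ ∧ HasCompactSupport φ ∧
    bmoNorm n (b - φ) < ε

/-- The conjugate exponent `p' = p/(p-1)`. -/
def conjExp (p : ℝ) : ℝ := p / (p - 1)

/-- The Muckenhoupt class `A_p`. -/
def MuckenhouptAp (n : ℕ) (p : ℝ) (w : Rn n → ℝ) : Prop :=
  (∀ x, 0 ≤ w x) ∧ LocallyIntegrable w volume ∧
  ∃ C : ℝ, ∀ (c : Rn n) (d : ℝ), 0 < d →
    (⨍ x in cube n c d, w x) *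
      (⨍ x in cube n c d, w x ^ (1 - conjExp p)) ^ (p / conjExp p) ≤ C

/-- The `A_p` characteristic constant `[w]_{A_p}`. -/
def apConst (n : ℕ) (p : ℝ) (w : Rn n → ℝ) : ℝ :=
  ⨆ cd : Rn n × {d : ℝ // 0 < d},
    (⨍ x in cube n cd.1 cd.2.1, w x) *
      (⨍ x in cube n cd.1 cd.2.1, w x ^ (1 - conjExp p)) ^ (p / conjExp p)

/-- The bilinear class `A_{P,q}` for `P = (p₁,p₂)`. -/
def MuckenhouptAPq (n : ℕ) (p₁ p₂ q : ℝ) (w₁ w₂ : Rn n → ℝ) : Prop :=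
  ∃ C : ℝ, ∀ (c : Rn n) (d : ℝ), 0 < d →
    (⨍ x in cube n c d, (w₁ x * w₂ x) ^ q) *
      (⨍ x in cube n c d, w₁ x ^ (-(conjExp p₁))) ^ (q / conjExp p₁) *
      (⨍ x in cube n c d, w₂ x ^ (-(conjExp p₂))) ^ (q / conjExp p₂) ≤ C

/-- The kernel of the bilinear fractional integral `I_α`. -/
def fracKernel (n : ℕ) (α : ℝ) (x y z : Rn n) : ℝ :=
  (‖x - y‖ ^ 2 + ‖x - z‖ ^ 2) ^ (-((n : ℝ) - α / 2))

/-- The bilinear fractional integral operator `I_α`. -/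
def Iop (n : ℕ) (α : ℝ) (f g : Rn n → ℝ) (x : Rn n) : ℝ :=
  ∫ y, ∫ z, fracKernel n α x y z * (f y * g z)

/-- The first commutator `[b, I_α]₁(f,g) = I_α(bf, g) - b · I_α(f,g)`. -/
def commI (n : ℕ) (α : ℝ) (b f g : Rn n → ℝ) : Rn n → ℝ :=
  fun x => Iop n α (fun y => b y * f y) g x - b x * Iop n α f g x

/-- The weighted Lᵖ norm `(∫ |f|^p w)^{1/p}` (with value in `ℝ≥0∞`). -/
def wNorm (n : ℕ) (p : ℝ) (w : Rn n → ℝ) (f : Rn n → ℝ) : ℝ≥0∞ :=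
  (∫⁻ x, ENNReal.ofReal (|f x| ^ p * w x)) ^ (1 / p)

/-- A bilinear operator `T` is compact from `L^{p₁}(w₁) × L^{p₂}(w₂)` to `L^q(μ)` when the
image of the product of unit balls is precompact in `L^q(μ)`; equivalently (by completeness),
every sequence in the image of the unit balls admits a subsequence which is Cauchy for the
`L^q(μ)` norm. -/
def BilinCompact (n : ℕ) (p₁ p₂ q : ℝ) (w₁ w₂ μ : Rn n → ℝ)
    (T : (Rn n → ℝ) → (Rn n → ℝ) → Rn n → ℝ) : Prop :=
  ∀ F G : ℕ → Rn n → ℝ,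
    (∀ j, wNorm n p₁ w₁ (F j) ≤ 1) → (∀ j, wNorm n p₂ w₂ (G j) ≤ 1) →
    ∃ φ : ℕ → ℕ, StrictMono φ ∧
      ∀ ε : ℝ, 0 < ε → ∃ N : ℕ, ∀ j ≥ N, ∀ k ≥ N,
        wNorm n q μ (fun x => T (F (φ j)) (G (φ j)) x - T (F (φ k)) (G (φ k)) x)
          < ENNReal.ofReal ε

/-- The smoothly truncated kernel `K^δ` with implicit constant `A`. -/
def IsTruncKernel (n : ℕ) (α δ A : ℝ) (K : Rn n → Rn n → Rn n → ℝ) : Prop :=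
  ContDiff ℝ 1 (fun pt : Rn n × Rn n × Rn n => K pt.1 pt.2.1 pt.2.2) ∧
  (∀ x y z, 2 * δ < max ‖x - y‖ ‖x - z‖ → K x y z = fracKernel n α x y z) ∧
  (∀ x y z, max ‖x - y‖ ‖x - z‖ < δ → K x y z = 0) ∧
  (∀ x y z : Rn n, |K x y z| ≤ A * (‖x - y‖ + ‖x - z‖) ^ (-(2 * (n : ℝ) - α))) ∧
  (∀ x y z : Rn n,
    ‖fderiv ℝ (fun pt : Rn n × Rn n × Rn n => K pt.1 pt.2.1 pt.2.2) (x, y, z)‖ ≤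
      A * (‖x - y‖ + ‖x - z‖) ^ (-(2 * (n : ℝ) - α - 1)))

/-- The bilinear operator with kernel `K`. -/
def IopK (n : ℕ) (K : Rn n → Rn n → Rn n → ℝ) (f g : Rn n → ℝ) (x : Rn n) : ℝ :=
  ∫ y, ∫ z, K x y z * (f y * g z)

/-- The first commutator of the truncated operator. -/
def commIK (n : ℕ) (K : Rn n → Rn n → Rn n → ℝ) (b f g : Rn n → ℝ) : Rn n → ℝ :=
  fun x => IopK n K (fun y => b y * f y) g x - b x * IopK n K f g x

/-- The bilinear fractional maximal function `M_α`. -/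
def Mmax (n : ℕ) (α : ℝ) (f g : Rn n → ℝ) (x : Rn n) : ℝ :=
  ⨆ cd : {cd : Rn n × ℝ // 0 < cd.2 ∧ x ∈ cube n cd.1 cd.2},
    ((cd : Rn n × ℝ).2 ^ n) ^ (α / n) *
      ((⨍ y in cube n (cd : Rn n × ℝ).1 (cd : Rn n × ℝ).2, |f y|) *
        (⨍ z in cube n (cd : Rn n × ℝ).1 (cd : Rn n × ℝ).2, |g z|))

/-- The test function `f_j` associated to the cube with center `c`, side `d` and symbol `b`:
`f_j = |Q|^{-1/p₁} (sgn(b - b_Q) - c₀) χ_Q` where `c₀ = ⨍_Q sgn(b - b_Q)`. -/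
def testF (n : ℕ) (p₁ : ℝ) (b : Rn n → ℝ) (c : Rn n) (d : ℝ) : Rn n → ℝ :=
  indicator (cube n c d) fun y =>
    (d ^ n) ^ (-(1 / p₁)) *
      (Real.sign (b y - cubeAvg n b c d) -
        ⨍ z in cube n c d, Real.sign (b z - cubeAvg n b c d))

/-- The test function `g_j = |Q|^{-1/p₂} χ_Q` associated to the cube with center `c`, side `d`. -/
def testG (n : ℕ) (p₂ : ℝ) (c : Rn n) (d : ℝ) : Rn n → ℝ :=
  indicator (cube n c d) fun _ => (d ^ n) ^ (-(1 / p₂))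

end

namespace JN

variable {n : ℕ}

lemma avg_bound {X : Type*} [MeasurableSpace X] {μ : Measure X} {A : Set X} (h0 : μ A ≠ 0)
    (h1 : μ A ≠ ∞) {b : X → ℝ} (hb : IntegrableOn b A μ) (m : ℝ) :
    ENNReal.ofReal |(⨍ x in A, b x ∂μ) - m| * μ A ≤ ∫⁻ x in A, ENNReal.ofReal |b x - m| ∂μ := by
  have hA : μ.real A ≠ 0 := by
    rw [Measure.real, Ne, ENNReal.toReal_eq_zero_iff]; tauto
  have e : ∫ x in A, (b x - m) ∂μ = μ.real A * ((⨍ x in A, b x ∂μ) - m) := by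
    rw [integral_sub hb (by exact integrableOn_const h1), setAverage_eq]
    simp
    field_simp
  have h2 := enorm_integral_le_lintegral_enorm (μ := μ.restrict A) (fun x => b x - m)
  rw [e] at h2
  have e2 : ‖μ.real A * ((⨍ x in A, b x ∂μ) - m)‖ₑ = ENNReal.ofReal |(⨍ x in A, b x ∂μ) - m| * μ A := by
    rw [enorm_mul, mul_comm, Real.enorm_eq_ofReal_abs, Real.enorm_eq_ofReal_abs,
      abs_of_nonneg measureReal_nonneg, Measure.real, ENNReal.ofReal_toReal h1]
  rw [e2] at h2
  refine h2.trans (le_of_eq ?_)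
  simp only [Real.enorm_eq_ofReal_abs]

noncomputable def avg (b : (Fin n → ℝ) → ℝ) (c : Fin n → ℝ) (r : ℝ) : ℝ :=
  ⨍ x in Metric.closedBall c r, b x

noncomputable def sgnv (c x : Fin n → ℝ) : Fin n → Bool := fun i => decide (c i < x i)

noncomputable def chld (c : Fin n → ℝ) (r : ℝ) (e : Fin n → Bool) : Fin n → ℝ :=
  fun i => c i + (if e i then r / 2 else -(r / 2))

noncomputable def cseq : ℕ → (Fin n → ℝ) → ℝ → (Fin n → ℝ) → (Fin n → ℝ)
  | 0, c, _, _ => c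
  | N+1, c, r, x => cseq N (chld c r (sgnv c x)) (r/2) x

noncomputable def EN (b : (Fin n → ℝ) → ℝ) (l : ℝ) (N : ℕ) (c : Fin n → ℝ) (r m : ℝ) : ℝ≥0∞ :=
  ∫⁻ x in Metric.closedBall c r,
    ENNReal.ofReal (Real.exp (l * |avg b (cseq N c r x) (r / 2 ^ N) - m|))

lemma mem_chld {c x : Fin n → ℝ} {r : ℝ} (hr : 0 < r) (hx : x ∈ Metric.closedBall c r) :
    x ∈ Metric.closedBall (chld c r (sgnv c x)) (r/2) := by
  rw [Metric.mem_closedBall, dist_pi_le_iff (by positivity)] at *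
  intro i
  have := hx i
  rw [Real.dist_eq, abs_le] at *
  simp only [chld, sgnv, decide_eq_true_eq]
  split_ifs with h <;> constructor <;> linarith

lemma chld_sub {c : Fin n → ℝ} {r : ℝ} (hr : 0 < r) (e : Fin n → Bool) :
    Metric.closedBall (chld c r e) (r/2) ⊆ Metric.closedBall c r := by
  intro x hx
  rw [Metric.mem_closedBall, dist_pi_le_iff (by positivity)] at *
  intro i
  have := hx i
  rw [Real.dist_eq, abs_le] at *
  simp only [chld] at this
  split_ifs at this with h <;> constructor <;> linarith

lemma mem_cseq (N : ℕ) : ∀ {c x : Fin n → ℝ} {r : ℝ}, 0 < r → x ∈ Metric.closedBall c r →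
    x ∈ Metric.closedBall (cseq N c r x) (r/2^N) := by
  induction N with
  | zero => intro c x r hr hx; simpa [cseq] using hx
  | succ N ih =>
    intro c x r hr hx
    have := ih (half_pos hr) (mem_chld hr hx)
    rw [pow_succ', ← div_div]
    exact this

lemma sgnv_meas (c : Fin n → ℝ) : Measurable (sgnv c) := by
  refine measurable_pi_iff.2 fun i => ?_
  exact measurable_to_bool (by
    have : (fun x : Fin n → ℝ => sgnv c x i) ⁻¹' {true} = {x | c i < x i} := by
      ext x; simp [sgnv]
    rw [this]
    exact measurableSet_lt measurable_const (measurable_pi_apply i))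

lemma bN_meas (b : (Fin n → ℝ) → ℝ) (N : ℕ) : ∀ (c : Fin n → ℝ) (r s : ℝ),
    Measurable fun x => avg b (cseq N c r x) s := by
  induction N with
  | zero => intro c r s; simp only [cseq]; exact measurable_const
  | succ N ih =>
    intro c r s
    have h : Measurable (fun p : (Fin n → Bool) × (Fin n → ℝ) =>
        avg b (cseq N (chld c r p.1) (r/2) p.2) s) :=
      measurable_from_prod_countable_right fun e => ih (chld c r e) (r/2) s
    simp only [cseq]
    exact h.comp (f := fun x => (sgnv c x, x)) ((sgnv_meas c).prodMk measurable_id)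

lemma chld_aedisj (c : Fin n → ℝ) {r : ℝ} (hr : 0 < r) :
    Pairwise (Function.onFun (AEDisjoint volume) fun e => Metric.closedBall (chld c r e) (r/2)) := by
  intro e e' hne
  obtain ⟨i, hi⟩ := Function.ne_iff.1 hne
  refine measure_mono_null (t := {x | x i = c i}) ?_ (Measure.pi_hyperplane _ i _)
  rintro x ⟨h1, h2⟩
  rw [Metric.mem_closedBall, dist_pi_le_iff (by positivity)] at h1 h2
  have h1 := h1 i
  have h2 := h2 i
  rw [Real.dist_eq, abs_le] at h1 h2
  simp only [chld] at h1 h2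
  change x i = c i
  cases h : e i <;> cases h' : e' i <;> simp [h, h'] at h1 h2 hi <;> linarith

lemma sum_chld (c : Fin n → ℝ) {r : ℝ} (hr : 0 < r) (f : (Fin n → ℝ) → ℝ≥0∞) :
    ∑ e : Fin n → Bool, ∫⁻ x in Metric.closedBall (chld c r e) (r/2), f x
      = ∫⁻ x in Metric.closedBall c r, f x := by
  have h := lintegral_iUnion₀ (μ := volume)
    (s := fun e : Fin n → Bool => Metric.closedBall (chld c r e) (r/2))
    (fun i => Metric.isClosed_closedBall.measurableSet.nullMeasurableSet) (chld_aedisj c hr) f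
  rw [tsum_fintype] at h
  rw [← h]
  congr 2
  refine subset_antisymm (iUnion_subset fun e => chld_sub hr e) fun x hx => ?_
  exact mem_iUnion.2 ⟨_, mem_chld hr hx⟩

lemma sum_chld_vol (c : Fin n → ℝ) {r : ℝ} (hr : 0 < r) :
    ∑ e : Fin n → Bool, volume (Metric.closedBall (chld c r e) (r/2))
      = volume (Metric.closedBall c r) := by
  simpa using sum_chld c hr (fun _ => 1)

lemma chld_ae_eq (c : Fin n → ℝ) {r : ℝ} (hr : 0 < r) (e : Fin n → Bool) :
    ∀ᵐ x, x ∈ Metric.closedBall (chld c r e) (r/2) → sgnv c x = e := by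
  have h : ∀ᵐ x : Fin n → ℝ, ∀ i, x i ≠ c i := by
    rw [ae_all_iff]
    intro i
    have := Measure.pi_hyperplane (fun _ : Fin n => (volume : Measure ℝ)) i (c i)
    rw [ae_iff]
    simp only [not_not, ne_eq]
    exact this
  filter_upwards [h] with x hx h1
  rw [Metric.mem_closedBall, dist_pi_le_iff (by positivity)] at h1
  funext i
  have h1 := h1 i
  have hx := hx i
  rw [Real.dist_eq, abs_le] at h1
  simp only [chld] at h1
  cases h : e i
  · simp [h] at h1; simp [sgnv]; linarith
  · simp [h] at h1; simp [sgnv]; exact lt_of_le_of_ne (by linarith) (Ne.symm hx)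

lemma EN_succ (b : (Fin n → ℝ) → ℝ) (l : ℝ) (N : ℕ) (c : Fin n → ℝ) {r : ℝ} (hr : 0 < r) (m : ℝ) :
    EN b l (N+1) c r m = ∑ e : Fin n → Bool, EN b l N (chld c r e) (r/2) m := by
  unfold EN
  rw [← sum_chld c hr]
  refine Finset.sum_congr rfl fun e _ => ?_
  refine setLIntegral_congr_fun_ae Metric.isClosed_closedBall.measurableSet ?_
  filter_upwards [chld_ae_eq c hr e] with x hx h
  simp only [cseq]
  rw [hx h, pow_succ', ← div_div]

lemma vol_pos (c : Fin n → ℝ) {r : ℝ} (hr : 0 < r) : volume (Metric.closedBall c r) ≠ 0 :=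
  (Metric.measure_closedBall_pos volume c hr).ne'

lemma vol_fin (c : Fin n → ℝ) (r : ℝ) : volume (Metric.closedBall c r) ≠ ∞ :=
  measure_closedBall_lt_top.ne

/-- change of cube -/
lemma avg_diff {b : (Fin n → ℝ) → ℝ} (hb : LocallyIntegrable b volume)
    (hosc : ∀ c r, 0 < r → ∫⁻ x in Metric.closedBall c r, ENNReal.ofReal |b x - avg b c r|
      ≤ volume (Metric.closedBall c r))
    {c c' : Fin n → ℝ} {r s : ℝ} (hr : 0 < r) (hs : 0 < s)
    (hsub : Metric.closedBall c s ⊆ Metric.closedBall c' r) (hrs : r ≤ 2 * s) :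
    |avg b c s - avg b c' r| ≤ 2 ^ n := by
  have h1 := avg_bound (vol_pos c hs) (vol_fin c s)
    (hb.integrableOn_isCompact (isCompact_closedBall c s)) (avg b c' r)
  have h2 : ∫⁻ x in Metric.closedBall c s, ENNReal.ofReal |b x - avg b c' r|
      ≤ volume (Metric.closedBall c' r) :=
    (lintegral_mono_set hsub).trans (hosc c' r hr)
  have h3 := h1.trans h2
  rw [Real.volume_pi_closedBall _ hr.le, Real.volume_pi_closedBall _ hs.le,
    ← ENNReal.ofReal_mul (abs_nonneg _), ENNReal.ofReal_le_ofReal_iff (by positivity)] at h3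
  simp only [Fintype.card_fin] at h3
  have h4 : (2 * r) ^ n ≤ 2 ^ n * (2 * s) ^ n := by
    rw [← mul_pow]; gcongr
  exact le_of_mul_le_mul_right (h3.trans h4) (by positivity)

lemma jn_step {b : (Fin n → ℝ) → ℝ} (hb : LocallyIntegrable b volume)
    (hosc : ∀ c r, 0 < r → ∫⁻ x in Metric.closedBall c r, ENNReal.ofReal |b x - avg b c r|
      ≤ volume (Metric.closedBall c r))
    {l : ℝ} (hl : 0 < l) (hl2 : Real.exp (l * (2 + 2 ^ n)) ≤ 3 / 2) (N : ℕ) :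
    (∀ c r, 0 < r → EN b l N c r (avg b c r) ≤
      ENNReal.ofReal (4 * Real.exp (2 * l)) * volume (Metric.closedBall c r)) ∧
    (∀ c r m, 0 < r → |avg b c r - m| ≤ 2 + 2 ^ n → EN b l N c r m ≤
      ENNReal.ofReal (Real.exp (2 * l)) * volume (Metric.closedBall c r) +
      ENNReal.ofReal (3 * Real.exp (2 * l)) *
        ∫⁻ x in Metric.closedBall c r, ENNReal.ofReal |b x - m|) := by
  have key : ∀ N : ℕ, (∀ c r, 0 < r → EN b l N c r (avg b c r) ≤
      ENNReal.ofReal (4 * Real.exp (2 * l)) * volume (Metric.closedBall c r)) →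
      ∀ c r m, 0 < r → |avg b c r - m| ≤ 2 + 2 ^ n → 2 < |avg b c r - m| → EN b l N c r m ≤
      ENNReal.ofReal (Real.exp (2 * l)) * volume (Metric.closedBall c r) +
      ENNReal.ofReal (3 * Real.exp (2 * l)) *
        ∫⁻ x in Metric.closedBall c r, ENNReal.ofReal |b x - m| := by
    intro N hP c r m hr hm hm2
    refine le_trans ?_ le_add_self
    have h1 : EN b l N c r m ≤ ENNReal.ofReal (3/2) * EN b l N c r (avg b c r) := by
      unfold EN
      rw [← lintegral_const_mul' _ _ ENNReal.ofReal_ne_top]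
      refine lintegral_mono fun x => ?_
      rw [← ENNReal.ofReal_mul (by norm_num)]
      refine ENNReal.ofReal_le_ofReal ?_
      refine le_trans ?_ (mul_le_mul_of_nonneg_right hl2 (Real.exp_pos _).le)
      rw [← Real.exp_add]
      refine Real.exp_le_exp.2 ?_
      rw [← mul_add]
      refine mul_le_mul_of_nonneg_left ?_ hl.le
      have := abs_sub_le (avg b (cseq N c r x) (r / 2 ^ N)) (avg b c r) m
      linarith
    have h2 := avg_bound (vol_pos c hr) (vol_fin c r)
      (hb.integrableOn_isCompact (isCompact_closedBall c r)) m
    calc _ ≤ _ := h1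
      _ ≤ ENNReal.ofReal (3/2) * (ENNReal.ofReal (4 * Real.exp (2 * l)) * volume (Metric.closedBall c r)) := by
          gcongr; exact hP c r hr
      _ = ENNReal.ofReal (3 * Real.exp (2 * l)) * (ENNReal.ofReal 2 * volume (Metric.closedBall c r)) := by
          rw [← mul_assoc, ← mul_assoc, ← ENNReal.ofReal_mul (by norm_num), ← ENNReal.ofReal_mul (by positivity)]
          congr 2; ring
      _ ≤ _ := by
          gcongr
          refine le_trans ?_ h2
          gcongr
          exact hm2.le
  have sumR : ∀ N : ℕ, (∀ c r m, 0 < r → |avg b c r - m| ≤ 2 + 2 ^ n → EN b l N c r m ≤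
      ENNReal.ofReal (Real.exp (2 * l)) * volume (Metric.closedBall c r) +
      ENNReal.ofReal (3 * Real.exp (2 * l)) *
        ∫⁻ x in Metric.closedBall c r, ENNReal.ofReal |b x - m|) →
      ∀ c r m, 0 < r → |avg b c r - m| ≤ 2 → EN b l (N+1) c r m ≤
      ENNReal.ofReal (Real.exp (2 * l)) * volume (Metric.closedBall c r) +
      ENNReal.ofReal (3 * Real.exp (2 * l)) *
        ∫⁻ x in Metric.closedBall c r, ENNReal.ofReal |b x - m| := by
    intro N hR c r m hr hm
    rw [EN_succ _ _ _ _ hr]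
    refine (Finset.sum_le_sum fun e _ => hR (chld c r e) (r/2) m (half_pos hr) ?_).trans ?_
    · have h1 := avg_diff hb hosc hr (half_pos hr) (chld_sub (c := c) hr e) (by linarith)
      have := abs_sub_le (avg b (chld c r e) (r/2)) (avg b c r) m
      linarith
    · rw [Finset.sum_add_distrib, ← Finset.mul_sum, ← Finset.mul_sum, sum_chld c hr, sum_chld_vol c hr]
  induction N with
  | zero =>
    have P0 : ∀ c r, 0 < r → EN b l 0 c r (avg b c r) ≤
      ENNReal.ofReal (4 * Real.exp (2 * l)) * volume (Metric.closedBall c r) := by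
      intro c r hr
      have : (1:ℝ) ≤ 4 * Real.exp (2 * l) := by
        have := Real.add_one_le_exp (2*l); linarith
      simp only [EN, cseq, pow_zero, div_one, sub_self, abs_zero, mul_zero, Real.exp_zero,
        ENNReal.ofReal_one, lintegral_const, Measure.restrict_apply_univ]
      gcongr
      exact ENNReal.one_le_ofReal.2 this
    refine ⟨P0, fun c r m hr hm => ?_⟩
    by_cases h2 : 2 < |avg b c r - m|
    · exact key 0 P0 c r m hr hm h2
    · refine le_trans ?_ le_self_add
      simp only [EN, cseq, pow_zero, div_one, lintegral_const, Measure.restrict_apply_univ]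
      rw [mul_comm 2 l]
      gcongr
      exact not_lt.1 h2
  | succ N ih =>
    have P : ∀ c r, 0 < r → EN b l (N+1) c r (avg b c r) ≤
      ENNReal.ofReal (4 * Real.exp (2 * l)) * volume (Metric.closedBall c r) := by
      intro c r hr
      refine (sumR N ih.2 c r _ hr (by simp)).trans ?_
      calc _ ≤ ENNReal.ofReal (Real.exp (2 * l)) * volume (Metric.closedBall c r) +
            ENNReal.ofReal (3 * Real.exp (2 * l)) * volume (Metric.closedBall c r) := by
              gcongr; exact hosc c r hr
        _ = _ := by
          rw [← add_mul, ← ENNReal.ofReal_add (by positivity) (by positivity)]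
          congr 2; ring
    refine ⟨P, fun c r m hr hm => ?_⟩
    by_cases h2 : 2 < |avg b c r - m|
    · exact key _ P c r m hr hm h2
    · exact sumR N ih.2 c r m hr (not_lt.1 h2)

theorem john_nirenberg {b : (Fin n → ℝ) → ℝ} (hb : LocallyIntegrable b volume)
    (hosc : ∀ c r, 0 < r → ∫⁻ x in Metric.closedBall c r, ENNReal.ofReal |b x - avg b c r|
      ≤ volume (Metric.closedBall c r))
    {l : ℝ} (hl : 0 < l) (hl2 : Real.exp (l * (2 + 2 ^ n)) ≤ 3 / 2) (c : Fin n → ℝ) {r : ℝ}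
    (hr : 0 < r) :
    ∫⁻ x in Metric.closedBall c r, ENNReal.ofReal (Real.exp (l * |b x - avg b c r|))
      ≤ ENNReal.ofReal (4 * Real.exp (2 * l)) * volume (Metric.closedBall c r) := by
  have hlim : Tendsto (fun N : ℕ => r / 2 ^ N) atTop (𝓝[>] 0) := by
    refine tendsto_nhdsWithin_iff.2 ⟨?_, Eventually.of_forall fun N => by simp; positivity⟩
    exact tendsto_const_nhds.div_atTop (tendsto_pow_atTop_atTop_of_one_lt (by norm_num))
  have hae := IsUnifLocDoublingMeasure.ae_tendsto_average.{0,0,0} volume hb 1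
  have hF := lintegral_liminf_le (μ := volume.restrict (Metric.closedBall c r)) (u := atTop)
    (f := fun N : ℕ => fun x => ENNReal.ofReal (Real.exp (l * |avg b (cseq N c r x) (r / 2 ^ N) - avg b c r|)))
    (fun N => by
      have := bN_meas b N c r (r/2^N)
      fun_prop)
  calc _ = ∫⁻ x in Metric.closedBall c r, liminf (fun N : ℕ => ENNReal.ofReal
          (Real.exp (l * |avg b (cseq N c r x) (r / 2 ^ N) - avg b c r|))) atTop := by
        refine setLIntegral_congr_fun_ae Metric.isClosed_closedBall.measurableSet ?_
        filter_upwards [hae] with x hx hxm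
        have h := hx (fun N => cseq N c r x) (fun N : ℕ => r / 2^N) hlim
          (Eventually.of_forall fun N => by rw [one_mul]; exact mem_cseq N hr hxm)
        refine (Tendsto.liminf_eq ?_).symm
        refine ENNReal.tendsto_ofReal ?_
        refine (Real.continuous_exp.tendsto _).comp ?_
        exact ((h.sub_const _).abs).const_mul l
    _ ≤ _ := hF
    _ ≤ _ := by
        refine liminf_le_of_frequently_le' (Frequently.of_forall fun N => ?_)
        exact (jn_step hb hosc hl hl2 N).1 c r hr

end JN

namespace JN

variable {n : ℕ}

lemma avg_growth {b : (Fin n → ℝ) → ℝ} (hb : LocallyIntegrable b volume)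
    (hosc : ∀ c r, 0 < r → ∫⁻ x in Metric.closedBall c r, ENNReal.ofReal |b x - avg b c r|
      ≤ volume (Metric.closedBall c r)) (c : Fin n → ℝ) {r : ℝ} (hr : 0 < r) (k : ℕ) :
    ∀ ρ : ℝ, 1 ≤ ρ → ρ ≤ 2 ^ k → |avg b c r - avg b c (ρ * r)| ≤ 4 * 2 ^ n * Real.sqrt ρ := by
  induction k with
  | zero =>
    intro ρ h1 h2
    have : ρ = 1 := by rw [pow_zero] at h2; linarith
    subst this
    simp
  | succ k ih =>
    intro ρ h1 h2
    have hs : 1 ≤ Real.sqrt ρ := Real.one_le_sqrt.2 h1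
    have hp : (0:ℝ) < 2 ^ n := by positivity
    by_cases h : ρ ≤ 2
    · have h3 := avg_diff hb hosc (c := c) (c' := c) (r := ρ * r) (s := r) (by positivity) hr
        (Metric.closedBall_subset_closedBall (by nlinarith)) (by nlinarith)
      nlinarith
    · push Not at h
      have h3 := avg_diff hb hosc (c := c) (c' := c) (r := ρ * r) (s := ρ / 2 * r) (by positivity)
        (by positivity) (Metric.closedBall_subset_closedBall (by nlinarith)) (by nlinarith)
      have h4 := ih (ρ / 2) (by linarith) (by rw [pow_succ] at h2; linarith)
      have h5 := abs_sub_le (avg b c r) (avg b c (ρ / 2 * r)) (avg b c (ρ * r))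
      have h6 : Real.sqrt (ρ / 2) ≤ 3 / 4 * Real.sqrt ρ := by
        rw [Real.sqrt_le_left (by positivity), mul_pow, Real.sq_sqrt (by linarith)]
        linarith
      have h7 : 4 * 2 ^ n * Real.sqrt (ρ / 2) ≤ 4 * 2 ^ n * (3 / 4 * Real.sqrt ρ) := by gcongr
      have h8 : 2 ^ n * 1 ≤ 2 ^ n * Real.sqrt ρ := by gcongr
      linarith

lemma add_rpow_le {u v q : ℝ} (hu : 0 ≤ u) (hv : 0 ≤ v) (hq : 0 < q) :
    (u + v) ^ q ≤ 2 ^ q * (u ^ q + v ^ q) := by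
  have h1 := Real.rpow_nonneg hu q
  have h2 := Real.rpow_nonneg hv q
  rcases le_total u v with h | h
  · calc (u + v) ^ q ≤ (2 * v) ^ q := Real.rpow_le_rpow (by linarith) (by linarith) hq.le
      _ = 2 ^ q * v ^ q := Real.mul_rpow (by norm_num) hv
      _ ≤ _ := by gcongr; linarith
  · calc (u + v) ^ q ≤ (2 * u) ^ q := Real.rpow_le_rpow (by linarith) (by linarith) hq.le
      _ = 2 ^ q * u ^ q := Real.mul_rpow (by norm_num) hu
      _ ≤ _ := by gcongr; linarith

lemma rpow_le_exp {u q l : ℝ} (hu : 0 ≤ u) (hq : 0 < q) (hl : 0 < l) :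
    u ^ q ≤ (q / l) ^ q * Real.exp (l * u) := by
  have h1 : u ≤ q / l * Real.exp (l * u / q) := by
    have := Real.add_one_le_exp (l * u / q)
    calc u = q / l * (l * u / q) := by field_simp
      _ ≤ _ := by gcongr; linarith
  calc u ^ q ≤ (q / l * Real.exp (l * u / q)) ^ q := Real.rpow_le_rpow hu h1 hq.le
    _ = _ := by
      rw [Real.mul_rpow (by positivity) (by positivity), ← Real.exp_mul]
      congr 2; field_simp

lemma lemBV (n : ℕ) {q : ℝ} (hq : 0 < q) : ∃ B : ℝ, 0 ≤ B ∧ ∀ b : (Fin n → ℝ) → ℝ,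
    LocallyIntegrable b volume →
    (∀ c r, 0 < r → ∫⁻ x in Metric.closedBall c r, ENNReal.ofReal |b x - avg b c r|
      ≤ volume (Metric.closedBall c r)) → ∀ (c : Fin n → ℝ) (r : ℝ), 0 < r → ∀ ρ : ℝ, 1 ≤ ρ →
    ∫⁻ x in Metric.closedBall c (ρ * r), ENNReal.ofReal (|b x - avg b c r| ^ q) ≤
      ENNReal.ofReal (B * ρ ^ (q / 2) * (2 * (ρ * r)) ^ n) := by
  obtain ⟨l, hl, hl2⟩ : ∃ l : ℝ, 0 < l ∧ Real.exp (l * (2 + 2 ^ n)) ≤ 3 / 2 := by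
    refine ⟨Real.log (3/2) / (2 + 2 ^ n), div_pos (Real.log_pos (by norm_num)) (by positivity), ?_⟩
    rw [div_mul_cancel₀ _ (by positivity), Real.exp_log (by norm_num)]
  set M : ℝ := 2 ^ q * (q / l) ^ q with hM
  set K : ℝ := 4 * Real.exp (2 * l) with hK
  set A : ℝ := 2 ^ q * (4 * 2 ^ n) ^ q with hA
  have hM0 : 0 ≤ M := by positivity
  have hK0 : 0 ≤ K := by positivity
  have hA0 : 0 ≤ A := by positivity
  refine ⟨M * K + A, by positivity, fun b hb hosc c r hr ρ hρ => ?_⟩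
  have hρr : 0 < ρ * r := by positivity
  obtain ⟨k, hk⟩ := pow_unbounded_of_one_lt ρ (one_lt_two)
  have hg := avg_growth hb hosc c hr k ρ hρ hk.le
  have hjn := john_nirenberg hb hosc hl hl2 c hρr
  have hρq : 1 ≤ ρ ^ (q / 2) := Real.one_le_rpow hρ (by positivity)
  have pt : ∀ x, ENNReal.ofReal (|b x - avg b c r| ^ q) ≤
      ENNReal.ofReal M * ENNReal.ofReal (Real.exp (l * |b x - avg b c (ρ * r)|)) +
      ENNReal.ofReal (A * ρ ^ (q / 2)) := by
    intro x
    rw [← ENNReal.ofReal_mul hM0, ← ENNReal.ofReal_add (by positivity) (by positivity)]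
    refine ENNReal.ofReal_le_ofReal ?_
    have h1 : |b x - avg b c r| ≤ |b x - avg b c (ρ * r)| + 4 * 2 ^ n * Real.sqrt ρ := by
      have := abs_sub_le (b x) (avg b c (ρ * r)) (avg b c r)
      rw [abs_sub_comm (avg b c (ρ * r))] at this
      linarith
    calc _ ≤ (|b x - avg b c (ρ * r)| + 4 * 2 ^ n * Real.sqrt ρ) ^ q :=
          Real.rpow_le_rpow (abs_nonneg _) h1 hq.le
      _ ≤ 2 ^ q * (|b x - avg b c (ρ * r)| ^ q + (4 * 2 ^ n * Real.sqrt ρ) ^ q) :=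
          add_rpow_le (abs_nonneg _) (by positivity) hq
      _ ≤ 2 ^ q * ((q / l) ^ q * Real.exp (l * |b x - avg b c (ρ * r)|) + (4 * 2 ^ n * Real.sqrt ρ) ^ q) := by
          gcongr
          exact rpow_le_exp (abs_nonneg _) hq hl
      _ = _ := by
          rw [Real.mul_rpow (by positivity) (by positivity), Real.sqrt_eq_rpow, ← Real.rpow_mul (by positivity)]
          rw [hM, hA, show 1 / 2 * q = q / 2 by ring]
          ring
  calc _ ≤ ∫⁻ x in Metric.closedBall c (ρ * r), (ENNReal.ofReal M * ENNReal.ofReal (Real.exp (l * |b x - avg b c (ρ * r)|)) +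
      ENNReal.ofReal (A * ρ ^ (q / 2))) := lintegral_mono pt
    _ = ENNReal.ofReal M * (∫⁻ x in Metric.closedBall c (ρ * r), ENNReal.ofReal (Real.exp (l * |b x - avg b c (ρ * r)|)))
       + ENNReal.ofReal (A * ρ ^ (q / 2)) * volume (Metric.closedBall c (ρ * r)) := by
        rw [lintegral_add_right _ measurable_const, lintegral_const_mul' _ _ ENNReal.ofReal_ne_top]
        simp
    _ ≤ ENNReal.ofReal M * (ENNReal.ofReal K * volume (Metric.closedBall c (ρ * r)))
       + ENNReal.ofReal (A * ρ ^ (q / 2)) * volume (Metric.closedBall c (ρ * r)) := by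
        gcongr
    _ = ENNReal.ofReal ((M * K + A * ρ ^ (q / 2)) * (2 * (ρ * r)) ^ n) := by
        rw [Real.volume_pi_closedBall _ hρr.le, ← mul_assoc, ← add_mul, ← ENNReal.ofReal_mul hM0,
          ← ENNReal.ofReal_add (by positivity) (by positivity), ← ENNReal.ofReal_mul (by positivity)]
        simp
    _ ≤ _ := by
        refine ENNReal.ofReal_le_ofReal ?_
        gcongr
        nlinarith [mul_nonneg hM0 hK0]

lemma cube_eq (c : Rn n) {d : ℝ} (hd : 0 < d) :
    cube n c d = (WithLp.ofLp : Rn n → (Fin n → ℝ)) ⁻¹' Metric.closedBall (WithLp.ofLp c) (d / 2) := by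
  ext x
  rw [mem_preimage, Metric.mem_closedBall, dist_pi_le_iff (by positivity)]
  simp only [Real.dist_eq]
  rfl

lemma mp : MeasurePreserving (WithLp.ofLp : Rn n → (Fin n → ℝ)) volume volume :=
  PiLp.volume_preserving_ofLp (Fin n)

lemma me : MeasurableEmbedding (WithLp.ofLp : Rn n → (Fin n → ℝ)) :=
  (MeasurableEquiv.toLp 2 (Fin n → ℝ)).symm.measurableEmbedding

lemma cube_meas (c : Rn n) {d : ℝ} (hd : 0 < d) : MeasurableSet (cube n c d) := by
  rw [cube_eq c hd]
  exact me.measurable Metric.isClosed_closedBall.measurableSet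

lemma cube_vol (c : Rn n) {d : ℝ} (hd : 0 < d) : volume (cube n c d) = ENNReal.ofReal (d ^ n) := by
  rw [cube_eq c hd, mp.measure_preimage_emb me, Real.volume_pi_closedBall _ (by positivity)]
  simp
  congr 1
  ring

lemma avg_eq (b : Rn n → ℝ) (c : Rn n) {d : ℝ} (hd : 0 < d) :
    cubeAvg n b c d = avg (fun v => b (WithLp.toLp 2 v)) (WithLp.ofLp c) (d / 2) := by
  unfold cubeAvg avg
  rw [setAverage_eq, setAverage_eq, cube_eq c hd]
  rw [← mp.setIntegral_preimage_emb me]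
  rw [Measure.real, mp.measure_preimage_emb me]
  rfl

lemma cube_compact (c : Rn n) {d : ℝ} (hd : 0 < d) : IsCompact (cube n c d) := by
  rw [cube_eq c hd]
  exact (PiLp.homeomorph 2 (fun _ : Fin n => ℝ)).isCompact_preimage.2 (isCompact_closedBall _ _)

lemma locint {b : Rn n → ℝ} (hb : LocallyIntegrable b volume) :
    LocallyIntegrable (fun v : Fin n → ℝ => b (WithLp.toLp 2 v)) volume := by
  rw [locallyIntegrable_iff]
  intro K hK
  have h : IsCompact ((WithLp.ofLp : Rn n → (Fin n → ℝ)) ⁻¹' K) :=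
    (PiLp.homeomorph 2 (fun _ : Fin n => ℝ)).isCompact_preimage.2 hK
  exact (mp.integrableOn_comp_preimage me).1 (hb.integrableOn_isCompact h)

lemma osc_le {b : Rn n → ℝ} (h1 : bmoNorm n b = 1) (c : Rn n) {d : ℝ} (hd : 0 < d) :
    osc n b c d ≤ 1 := by
  have hbdd : BddAbove (range fun cd : Rn n × {d : ℝ // 0 < d} => osc n b cd.1 cd.2.1) := by
    by_contra h
    have := Real.iSup_of_not_bddAbove h
    unfold bmoNorm at h1
    linarith
  rw [← h1]
  exact le_ciSup hbdd (c, ⟨d, hd⟩)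

lemma hosc_of {b : Rn n → ℝ} (hb : LocallyIntegrable b volume) (h1 : bmoNorm n b = 1) :
    ∀ (c : Fin n → ℝ) r, 0 < r → ∫⁻ x in Metric.closedBall c r,
      ENNReal.ofReal |b (WithLp.toLp 2 x) - avg (fun v => b (WithLp.toLp 2 v)) c r|
      ≤ volume (Metric.closedBall c r) := by
  intro c r hr
  have hd : 0 < 2 * r := by positivity
  have h := osc_le h1 (WithLp.toLp 2 c) hd
  unfold osc at h
  rw [avg_eq b _ hd, setAverage_eq] at h
  have e : 2 * r / 2 = r := by ring
  have hc := cube_eq (WithLp.toLp 2 c) hd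
  rw [e] at hc h
  simp only at hc h
  have hint : IntegrableOn (fun x => |b x - avg (fun v => b (WithLp.toLp 2 v)) c r|)
      (cube n (WithLp.toLp 2 c) (2 * r)) := by
    refine Integrable.abs (Integrable.sub (hb.integrableOn_isCompact (cube_compact _ hd)) ?_)
    exact integrableOn_const (cube_compact _ hd).measure_lt_top.ne
  rw [← mp.setLIntegral_comp_preimage_emb me, ← mp.measure_preimage_emb me, ← hc]
  have h2 := ofReal_integral_eq_lintegral_ofReal hint (Eventually.of_forall fun x => abs_nonneg _)
  refine (le_of_eq h2.symm).trans ?_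
  have hv := cube_vol (WithLp.toLp 2 c) hd
  rw [hv]
  refine ENNReal.ofReal_le_ofReal ?_
  rw [Measure.real, hv, ENNReal.toReal_ofReal (by positivity), smul_eq_mul,
    inv_mul_le_iff₀ (by positivity), mul_one] at h
  exact h

lemma lemB (n : ℕ) {q : ℝ} (hq : 0 < q) : ∃ B : ℝ, 0 ≤ B ∧ ∀ b : Rn n → ℝ,
    LocallyIntegrable b volume → bmoNorm n b = 1 →
    ∀ (c : Rn n) (d : ℝ), 0 < d → ∀ ρ : ℝ, 1 ≤ ρ →
    ∫⁻ x in cube n c (ρ * d), ENNReal.ofReal (|b x - cubeAvg n b c d| ^ q) ≤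
      ENNReal.ofReal (B * ρ ^ (q / 2) * (ρ * d) ^ n) := by
  obtain ⟨B, hB, h⟩ := lemBV n hq
  refine ⟨B, hB, fun b hb h1 c d hd ρ hρ => ?_⟩
  have := h _ (locint hb) (hosc_of hb h1) (WithLp.ofLp c) (d / 2) (by positivity) ρ hρ
  rw [← mp.setLIntegral_comp_preimage_emb me, ← mul_div_assoc, ← cube_eq c (by positivity),
    ← avg_eq b c hd, mul_div_cancel₀ _ (two_ne_zero)] at this
  exact this

end JN

namespace JN

variable {n : ℕ}

lemma ind_bound (c : Rn n) {d : ℝ} (hd : 0 < d) {f : Rn n → ℝ} {M : ℝ}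
    (h : ∀ x ∈ cube n c d, |f x| ≤ M) (h0 : ∀ x, x ∉ cube n c d → f x = 0) :
    |∫ x, f x| ≤ M * d ^ n := by
  have hi : Integrable ((cube n c d).indicator fun _ => M) (volume : Measure (Rn n)) := by
    rw [integrable_indicator_iff (cube_meas c hd)]
    exact integrableOn_const (cube_compact c hd).measure_lt_top.ne
  have h1 := norm_integral_le_of_norm_le (f := f) hi (Eventually.of_forall fun x => by
    by_cases hx : x ∈ cube n c d
    · rw [indicator_of_mem hx]; exact h x hx
    · rw [indicator_of_notMem hx, h0 x hx]; simp)
  rw [integral_indicator (cube_meas c hd), setIntegral_const, Measure.real, cube_vol c hd,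
    ENNReal.toReal_ofReal (by positivity), smul_eq_mul, mul_comm] at h1
  exact h1

lemma cube_norm {c y : Rn n} {d : ℝ} (hd : 0 < d) (hy : y ∈ cube n c d) :
    ‖y - c‖ ≤ Real.sqrt n * (d / 2) := by
  rw [EuclideanSpace.norm_eq]
  have : Real.sqrt n * (d / 2) = Real.sqrt (n * (d/2)^2) := by
    rw [Real.sqrt_mul (by positivity), Real.sqrt_sq (by positivity)]
  rw [this]
  refine Real.sqrt_le_sqrt ?_
  calc ∑ i, ‖(y - c) i‖ ^ 2 ≤ ∑ i : Fin n, (d / 2) ^ 2 := by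
        refine Finset.sum_le_sum fun i _ => ?_
        have := hy i
        rw [Real.norm_eq_abs]
        gcongr
        simpa using this
    _ = _ := by simp

lemma rpow_diff {s m t u : ℝ} (hs : 0 < s) (hm : 0 < m) (ht : m ≤ t) (hu : m ≤ u) :
    |t ^ (-s) - u ^ (-s)| ≤ s * m ^ (-s - 1) * |t - u| := by
  have := Convex.norm_image_sub_le_of_norm_deriv_le (𝕜 := ℝ) (f := fun x : ℝ => x ^ (-s))
    (s := Ici m) (x := u) (y := t) (C := s * m ^ (-s - 1))
    (fun x hx => by
      have hx : m ≤ x := hx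
      exact (Real.hasDerivAt_rpow_const (Or.inl (by linarith))).differentiableAt)
    (fun x hx => by
      have hx : m ≤ x := hx
      rw [(Real.hasDerivAt_rpow_const (p := -s) (Or.inl (show x ≠ 0 by linarith))).deriv]
      have hx0 : 0 < x := by linarith
      rw [norm_mul, norm_neg, Real.norm_of_nonneg hs.le, Real.norm_of_nonneg (by positivity)]
      gcongr s * ?_
      exact Real.rpow_le_rpow_of_nonpos hm hx (by linarith))
    (convex_Ici m) hu ht
  exact this

lemma kernel_diff {α : ℝ} (hα : α < 2 * n) {x y c z : Rn n} (hx : 0 < ‖x - c‖)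
    (hy : ‖y - c‖ ≤ ‖x - c‖ / 2) :
    |fracKernel n α x y z - fracKernel n α x c z| ≤
      ((n : ℝ) - α / 2) * (‖x - c‖ ^ 2 / 4) ^ (-((n : ℝ) - α / 2) - 1) *
        (‖y - c‖ * (5 / 2 * ‖x - c‖)) := by
  have h1 : ‖x - c‖ ≤ ‖x - y‖ + ‖y - c‖ := norm_sub_le_norm_sub_add_norm_sub x y c
  have h2 : ‖x - y‖ ≤ ‖x - c‖ + ‖y - c‖ := by
    rw [norm_sub_rev y c]; exact norm_sub_le_norm_sub_add_norm_sub x c y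
  have hxy : ‖x - c‖ / 2 ≤ ‖x - y‖ := by linarith
  have hz := sq_nonneg ‖x - z‖
  have hs : 0 < (n : ℝ) - α / 2 := by linarith
  have h3 := rpow_diff (s := (n : ℝ) - α / 2) (m := ‖x - c‖ ^ 2 / 4)
    (t := ‖x - y‖ ^ 2 + ‖x - z‖ ^ 2) (u := ‖x - c‖ ^ 2 + ‖x - z‖ ^ 2)
    hs (by positivity) (by nlinarith) (by nlinarith)
  refine h3.trans ?_
  have hy0 := norm_nonneg (y - c)
  gcongr
  rw [show ‖x - y‖ ^ 2 + ‖x - z‖ ^ 2 - (‖x - c‖ ^ 2 + ‖x - z‖ ^ 2)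
    = (‖x - y‖ - ‖x - c‖) * (‖x - y‖ + ‖x - c‖) by ring, abs_mul]
  gcongr
  · rw [abs_le]; constructor <;> linarith
  · rw [abs_of_nonneg (by positivity)]; linarith

lemma Iop_far {α : ℝ} (hα : α < 2 * n) {x c : Rn n} {d : ℝ} (hd : 0 < d) {f : Rn n → ℝ} {M G : ℝ}
    (hG : 0 ≤ G) (hx : 0 < ‖x - c‖) (hx2 : Real.sqrt n * d ≤ ‖x - c‖)
    (hf0 : ∀ y, y ∉ cube n c d → f y = 0) (hfM : ∀ y, |f y| ≤ M) (hfi : Integrable f)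
    (hf : ∫ y, f y = 0) :
    |Iop n α f (indicator (cube n c d) fun _ => G) x| ≤
      M * (((n : ℝ) - α / 2) * (‖x - c‖ ^ 2 / 4) ^ (-((n : ℝ) - α / 2) - 1) *
        (Real.sqrt n * (d / 2) * (5 / 2 * ‖x - c‖)) * G * d ^ n) * d ^ n := by
  set D := ((n : ℝ) - α / 2) * (‖x - c‖ ^ 2 / 4) ^ (-((n : ℝ) - α / 2) - 1) *
        (Real.sqrt n * (d / 2) * (5 / 2 * ‖x - c‖)) with hD
  have hs : 0 < (n : ℝ) - α / 2 := by linarith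
  have hM : 0 ≤ M := (abs_nonneg _).trans (hfM c)
  have hD0 : 0 ≤ D := by positivity
  set H : Rn n → ℝ := fun y => ∫ z, fracKernel n α x y z * (cube n c d).indicator (fun _ => G) z with hH
  have e1 : Iop n α f (indicator (cube n c d) fun _ => G) x = ∫ y, f y * H y := by
    unfold Iop
    congr 1
    ext y
    rw [hH, ← integral_const_mul]
    congr 1
    ext z
    ring
  rw [e1]
  have hki : ∀ y, ‖y - c‖ ≤ ‖x - c‖ / 2 →
      Integrable (fun z => fracKernel n α x y z * (cube n c d).indicator (fun _ => G) z) := by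
    intro y hy
    have h1 : ‖x - c‖ ≤ ‖x - y‖ + ‖y - c‖ := norm_sub_le_norm_sub_add_norm_sub x y c
    have h2 : 0 < ‖x - y‖ := by linarith
    refine Integrable.bdd_mul (c := (‖x - y‖ ^ 2) ^ (-((n : ℝ) - α / 2))) ?_ ?_ ?_
    · rw [integrable_indicator_iff (cube_meas c hd)]
      exact integrableOn_const (cube_compact c hd).measure_lt_top.ne
    · unfold fracKernel
      exact Measurable.aestronglyMeasurable (by fun_prop)
    · refine Eventually.of_forall fun z => ?_
      unfold fracKernel
      rw [Real.norm_of_nonneg (by positivity)]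
      exact Real.rpow_le_rpow_of_nonpos (by positivity) (by nlinarith [sq_nonneg ‖x - z‖]) (by linarith)
  by_cases hi : Integrable (fun y => f y * H y)
  swap
  · rw [integral_undef hi, abs_zero]; positivity
  have e2 : ∫ y, f y * H y = ∫ y, f y * (H y - H c) := by
    simp only [mul_sub]
    rw [integral_sub hi (hfi.mul_const _), integral_mul_const, hf]; simp
  rw [e2]
  refine ind_bound c hd (fun y hy => ?_) (fun y hy => by simp [hf0 y hy])
  have hyc := cube_norm hd hy
  rw [abs_mul]
  refine mul_le_mul (hfM y) ?_ (abs_nonneg _) hM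
  rw [hH]
  simp only
  rw [← integral_sub (hki y (by linarith)) (hki c (by simp; positivity))]
  refine ind_bound c hd (fun z hz => ?_) (fun z hz => by simp [hz])
  rw [indicator_of_mem hz, ← sub_mul, abs_mul, abs_of_nonneg hG]
  gcongr
  refine (kernel_diff hα hx (by linarith)).trans ?_
  rw [hD]
  gcongr

lemma ball_int (hn : 0 < n) {s : ℝ} (hs : s < n) :
    Integrable ((Metric.ball (0 : Rn n) 1).indicator fun u => ‖u‖ ^ (-s)) := by
  rw [integrable_indicator_iff measurableSet_ball]
  refine integrableOn_ball_of_norm_le_rpow (C := 1) (α := s) (by simp; omega) (by simpa using hs) ?_ ?_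
  · refine Eventually.of_forall fun x => ?_
    rw [one_mul, Real.norm_of_nonneg (by positivity)]
  · exact Measurable.aestronglyMeasurable (by fun_prop)

/-- `∫_{|u|<R} |u|^{-s}` by scaling. -/
lemma ball_scale (hn : 0 < n) {s R : ℝ} (hs : s < n) (hR : 0 < R) :
    Integrable ((Metric.ball (0 : Rn n) R).indicator fun u => ‖u‖ ^ (-s)) ∧
    ∫ u, (Metric.ball (0 : Rn n) R).indicator (fun u => ‖u‖ ^ (-s)) u = R ^ ((n : ℝ) - s) *
      ∫ u, (Metric.ball (0 : Rn n) 1).indicator (fun u => ‖u‖ ^ (-s)) u := by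
  have e : (Metric.ball (0 : Rn n) R).indicator (fun u => ‖u‖ ^ (-s)) =
      fun u => R ^ (-s) * (Metric.ball (0 : Rn n) 1).indicator (fun u => ‖u‖ ^ (-s)) (R⁻¹ • u) := by
    ext u
    have hm : R⁻¹ • u ∈ Metric.ball (0 : Rn n) 1 ↔ u ∈ Metric.ball (0 : Rn n) R := by
      simp only [mem_ball_zero_iff, norm_smul, norm_inv, Real.norm_of_nonneg hR.le]
      rw [inv_mul_lt_iff₀ hR, mul_one]
    by_cases h : u ∈ Metric.ball (0 : Rn n) R
    · rw [indicator_of_mem h, indicator_of_mem (hm.2 h), norm_smul, norm_inv, Real.norm_of_nonneg hR.le,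
        ← Real.mul_rpow hR.le (by positivity)]
      congr 1; field_simp
    · rw [indicator_of_notMem h, indicator_of_notMem (fun h' => h (hm.1 h')), mul_zero]
  rw [e]
  refine ⟨((ball_int hn hs).comp_smul (inv_ne_zero hR.ne')).const_mul _, ?_⟩
  rw [integral_const_mul, Measure.integral_comp_smul]
  simp only [finrank_euclideanSpace, Fintype.card_fin, inv_pow, inv_inv, smul_eq_mul]
  rw [abs_of_pos (by positivity), ← mul_assoc]
  congr 1
  rw [← Real.rpow_natCast, ← Real.rpow_add hR]
  congr 1; ring

lemma kernel_prod {α : ℝ} (hα : α < 2 * n) {x y z : Rn n} (hy : y ≠ x) (hz : z ≠ x) :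
    fracKernel n α x y z ≤ ‖x - y‖ ^ (-((n : ℝ) - α / 2)) * ‖x - z‖ ^ (-((n : ℝ) - α / 2)) := by
  have h1 : 0 < ‖x - y‖ := norm_pos_iff.2 (sub_ne_zero.2 hy.symm)
  have h2 : 0 < ‖x - z‖ := norm_pos_iff.2 (sub_ne_zero.2 hz.symm)
  rw [← Real.mul_rpow h1.le h2.le]
  unfold fracKernel
  exact Real.rpow_le_rpow_of_nonpos (by positivity)
    (by nlinarith [sq_nonneg (‖x - y‖ - ‖x - z‖), mul_pos h1 h2]) (by linarith)

lemma near_aux {α s : ℝ} {x c : Rn n} {d : ℝ} {w : Rn n → ℝ} {f : Rn n → ℝ} {M G : ℝ}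
    (hG : 0 ≤ G) (hM : 0 ≤ M)
    (hf0 : ∀ y, y ∉ cube n c d → f y = 0) (hfM : ∀ y, |f y| ≤ M)
    (hw0 : ∀ u, 0 ≤ w u) (hwQ : ∀ z ∈ cube n c d, w (x - z) = ‖x - z‖ ^ (-s))
    (hne : ∀ᵐ z : Rn n, z ≠ x)
    (hk : ∀ y z, y ≠ x → z ≠ x → fracKernel n α x y z ≤ ‖x - y‖ ^ (-s) * ‖x - z‖ ^ (-s))
    (hiW : Integrable (fun z => w (x - z))) (heW : ∫ z, w (x - z) = ∫ u, w u)
    (hW0 : 0 ≤ ∫ u, w u) :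
    |Iop n α f (indicator (cube n c d) fun _ => G) x| ≤ M * G * (∫ u, w u) ^ 2 := by
  have pt : ∀ y z, y ≠ x → z ≠ x →
      ‖fracKernel n α x y z * (f y * (cube n c d).indicator (fun _ => G) z)‖ ≤
        M * G * w (x - y) * w (x - z) := by
    intro y z hy hz
    have h1 := hw0 (x - y)
    have h2 := hw0 (x - z)
    have h3 : 0 ≤ M * G * w (x - y) * w (x - z) := by positivity
    by_cases hyQ : y ∈ cube n c d
    swap
    · rw [hf0 y hyQ, zero_mul, mul_zero, norm_zero]; exact h3
    by_cases hzQ : z ∈ cube n c d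
    swap
    · rw [indicator_of_notMem hzQ, mul_zero, mul_zero, norm_zero]; exact h3
    have hk0 : 0 ≤ fracKernel n α x y z := by unfold fracKernel; positivity
    rw [indicator_of_mem hzQ, norm_mul, norm_mul, Real.norm_of_nonneg hG,
      Real.norm_of_nonneg hk0, Real.norm_eq_abs]
    have h4 := hk y z hy hz
    rw [← hwQ y hyQ, ← hwQ z hzQ] at h4
    calc _ ≤ (w (x - y) * w (x - z)) * (M * G) :=
          mul_le_mul h4 (mul_le_mul_of_nonneg_right (hfM y) hG)
            (mul_nonneg (abs_nonneg _) hG) (mul_nonneg h1 h2)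
      _ = _ := by ring
  have inner : ∀ y, y ≠ x → ‖∫ z, fracKernel n α x y z * (f y * (cube n c d).indicator (fun _ => G) z)‖
      ≤ M * G * (∫ u, w u) * w (x - y) := by
    intro y hy
    refine (norm_integral_le_of_norm_le (hiW.const_mul (M * G * w (x - y)))
      (hne.mono fun z hz => pt y z hy hz)).trans (le_of_eq ?_)
    rw [integral_const_mul, heW]; ring
  have := norm_integral_le_of_norm_le (hiW.const_mul (M * G * (∫ u, w u))) (hne.mono inner)
  refine this.trans (le_of_eq ?_)
  rw [integral_const_mul, heW]; ring

lemma Iop_near (hn : 0 < n) {α : ℝ} (hα0 : 0 < α) (hα : α < 2 * n) {x c : Rn n} {d : ℝ} (hd : 0 < d)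
    {f : Rn n → ℝ} {M G : ℝ}
    (hG : 0 ≤ G) (hx2 : ‖x - c‖ ≤ Real.sqrt n * d)
    (hf0 : ∀ y, y ∉ cube n c d → f y = 0) (hfM : ∀ y, |f y| ≤ M) :
    |Iop n α f (indicator (cube n c d) fun _ => G) x| ≤
      M * G * ((2 * Real.sqrt n * d) ^ (α / 2) *
        ∫ u, (Metric.ball (0 : Rn n) 1).indicator (fun u => ‖u‖ ^ (-((n : ℝ) - α / 2))) u) ^ 2 := by
  set s := (n : ℝ) - α / 2 with hs
  have hs0 : 0 < s := by rw [hs]; linarith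
  set R := 2 * Real.sqrt n * d with hR
  have hsn : 0 < Real.sqrt n := Real.sqrt_pos.2 (by exact_mod_cast hn)
  have hR0 : 0 < R := by positivity
  have hM : 0 ≤ M := (abs_nonneg _).trans (hfM c)
  obtain ⟨hi, he⟩ := ball_scale hn (s := s) (R := R) (by rw [hs]; linarith) hR0
  rw [show (n : ℝ) - s = α / 2 by rw [hs]; ring] at he
  rw [← he]
  set w := (Metric.ball (0 : Rn n) R).indicator (fun u => ‖u‖ ^ (-s)) with hw
  have hiW : Integrable (fun z => w (x - z)) := hi.comp_sub_left x
  have heW : ∫ z, w (x - z) = ∫ u, w u := integral_sub_left_eq_self w volume x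
  have hW0 : 0 ≤ ∫ u, w u := integral_nonneg fun u => by
    rw [hw]; exact indicator_nonneg (fun u _ => by positivity) u
  have hwQ : ∀ z ∈ cube n c d, w (x - z) = ‖x - z‖ ^ (-s) := by
    intro z hz
    rw [hw, indicator_of_mem]
    rw [mem_ball_zero_iff]
    have h1 := cube_norm hd hz
    have h2 := norm_sub_le_norm_sub_add_norm_sub x c z
    rw [norm_sub_rev c z] at h2
    have : 0 < Real.sqrt n * d := by positivity
    rw [hR]; linarith
  have hw0 : ∀ u, 0 ≤ w u := fun u => by
    rw [hw]; exact indicator_nonneg (fun u _ => by positivity) u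
  have : Nontrivial (Rn n) := by
    have : Nonempty (Fin n) := ⟨⟨0, hn⟩⟩
    infer_instance
  have hne : ∀ᵐ z : Rn n, z ≠ x := by
    rw [ae_iff]; simp
  have hk : ∀ y z, y ≠ x → z ≠ x → fracKernel n α x y z ≤ ‖x - y‖ ^ (-s) * ‖x - z‖ ^ (-s) :=
    fun y z hy hz => kernel_prod hα hy hz
  exact near_aux (w := w) (s := s) (f := f) hG hM hf0 hfM hw0 hwQ hne hk hiW heW hW0

end JN

namespace JN

variable {n : ℕ}

lemma sign_meas : Measurable Real.sign := by
  unfold Real.sign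
  exact Measurable.ite measurableSet_Iio measurable_const
    (Measurable.ite measurableSet_Ioi measurable_const measurable_const)

lemma abs_sign_le (r : ℝ) : |Real.sign r| ≤ 1 := by
  rcases Real.sign_apply_eq r with h | h | h <;> rw [h] <;> simp

lemma sign_intOn {b : Rn n → ℝ} (hb : LocallyIntegrable b volume) (c : Rn n) {d : ℝ} (hd : 0 < d) (a : ℝ) :
    IntegrableOn (fun y => Real.sign (b y - a)) (cube n c d) volume := by
  have hm : AEStronglyMeasurable (fun y => Real.sign (b y - a)) volume :=
    (sign_meas.comp_aemeasurable (hb.aestronglyMeasurable.aemeasurable.sub_const a)).aestronglyMeasurable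
  refine Integrable.mono' (g := fun _ => (1 : ℝ))
    (integrableOn_const (cube_compact c hd).measure_lt_top.ne) hm.restrict ?_
  exact Eventually.of_forall fun y => abs_sign_le _

lemma testF_props {b : Rn n → ℝ} (hb : LocallyIntegrable b volume) (p₁ : ℝ) (c : Rn n) {d : ℝ} (hd : 0 < d) :
    (∀ y, y ∉ cube n c d → testF n p₁ b c d y = 0) ∧
    (∀ y, |testF n p₁ b c d y| ≤ 2 * (d ^ n) ^ (-(1 / p₁))) ∧
    Integrable (testF n p₁ b c d) ∧ ∫ y, testF n p₁ b c d y = 0 := by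
  have hF : 0 ≤ (d ^ n) ^ (-(1 / p₁)) := by positivity
  have hi := sign_intOn hb c hd (cubeAvg n b c d)
  have hav : |⨍ z in cube n c d, Real.sign (b z - cubeAvg n b c d)| ≤ 1 := by
    rw [setAverage_eq, smul_eq_mul, abs_mul, Measure.real, cube_vol c hd,
      ENNReal.toReal_ofReal (by positivity), abs_of_nonneg (by positivity)]
    have h1 := norm_setIntegral_le_of_norm_le_const (μ := volume) (s := cube n c d) (C := 1)
      (f := fun z => Real.sign (b z - cubeAvg n b c d)) (cube_compact c hd).measure_lt_top
      (fun z _ => abs_sign_le _)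
    rw [Measure.real, cube_vol c hd, ENNReal.toReal_ofReal (by positivity), one_mul, Real.norm_eq_abs] at h1
    rw [inv_mul_le_iff₀ (by positivity), mul_one]; exact h1
  refine ⟨fun y hy => indicator_of_notMem hy _, fun y => ?_, ?_, ?_⟩
  · unfold testF
    by_cases hy : y ∈ cube n c d
    · rw [indicator_of_mem hy, abs_mul, abs_of_nonneg hF, mul_comm]
      gcongr
      exact (abs_sub _ _).trans (by linarith [abs_sign_le (b y - cubeAvg n b c d)])
    · rw [indicator_of_notMem hy]; simp; positivity
  · unfold testF
    rw [integrable_indicator_iff (cube_meas c hd)]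
    exact (hi.sub (integrableOn_const (cube_compact c hd).measure_lt_top.ne)).const_mul _
  · unfold testF
    rw [integral_indicator (cube_meas c hd), integral_const_mul,
      integral_sub hi (integrableOn_const (cube_compact c hd).measure_lt_top.ne), setIntegral_const,
      setAverage_eq, smul_smul, mul_inv_cancel₀, one_smul, sub_self, mul_zero]
    rw [Measure.real, cube_vol c hd, ENNReal.toReal_ofReal (by positivity)]
    positivity

lemma FG_eq {p₁ p₂ q α d : ℝ} (hn : 0 < n) (hq : 1 / q = 1 / p₁ + 1 / p₂ - α / n) (hd : 0 < d) :
    (d ^ n) ^ (-(1 / p₁)) * (d ^ n) ^ (-(1 / p₂)) * d ^ α = d ^ (-((n : ℝ) / q)) := by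
  have hn' : (n : ℝ) ≠ 0 := by positivity
  rw [← Real.rpow_natCast, ← Real.rpow_mul hd.le, ← Real.rpow_mul hd.le, ← Real.rpow_add hd,
    ← Real.rpow_add hd]
  congr 1
  rw [div_eq_mul_one_div (n : ℝ) q, hq]
  field_simp
  ring

lemma lemA (hn : 0 < n) {p₁ p₂ q α : ℝ} (hα0 : 0 < α) (hα : α < 2 * n)
    (hq : 1 / q = 1 / p₁ + 1 / p₂ - α / n) :
    ∃ C, 0 ≤ C ∧ ∀ b : Rn n → ℝ, LocallyIntegrable b volume → ∀ (c : Rn n) (d : ℝ), 0 < d →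
      ∀ x, 0 < ‖x - c‖ → |Iop n α (testF n p₁ b c d) (testG n p₂ c d) x| ≤
        C * d ^ (-((n : ℝ) / q)) * (d / ‖x - c‖) ^ (2 * (n : ℝ) - α + 1) := by
  have hsn : 0 < Real.sqrt n := Real.sqrt_pos.2 (by exact_mod_cast hn)
  have hs : 0 < (n : ℝ) - α / 2 := by linarith
  set W := ∫ u, (Metric.ball (0 : Rn n) 1).indicator (fun u => ‖u‖ ^ (-((n : ℝ) - α / 2))) u with hW
  set K1 := 2 * ((n : ℝ) - α / 2) * 4 ^ ((n : ℝ) - α / 2 + 1) * Real.sqrt n * (5 / 4) with hK1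
  set K2 := 2 * W ^ 2 * (2 * Real.sqrt n) ^ α * Real.sqrt n ^ (2 * (n : ℝ) - α + 1) with hK2
  have hK1' : 0 ≤ K1 := by positivity
  have hK2' : 0 ≤ K2 := by positivity
  refine ⟨K1 + K2, by positivity, ?_⟩
  intro b hb c d hd x hx
  obtain ⟨hf0, hfM, hfi, hf⟩ := testF_props hb p₁ c hd
  have hG : 0 ≤ (d ^ n) ^ (-(1 / p₂)) := by positivity
  have hFG := FG_eq hn hq hd
  set F := (d ^ n) ^ (-(1 / p₁))
  set G := (d ^ n) ^ (-(1 / p₂))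
  set f := testF n p₁ b c d
  have hgt : testG n p₂ c d = indicator (cube n c d) fun _ => G := rfl
  rw [hgt]
  rw [← hFG]
  have hF : 0 ≤ F := by positivity
  set r := ‖x - c‖
  have hX : 0 ≤ F * G * d ^ α * (d / r) ^ (2 * (n : ℝ) - α + 1) := by positivity
  rcases le_total (Real.sqrt n * d) r with h | h
  · refine (Iop_far hα hd hG hx h hf0 hfM hfi hf).trans ?_
    have e1 : (r ^ 2 / 4) ^ (-((n : ℝ) - α / 2) - 1) * r =
        4 ^ ((n : ℝ) - α / 2 + 1) * r ^ (-(2 * (n : ℝ) - α + 1)) := by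
      rw [Real.div_rpow (by positivity) (by norm_num), ← Real.rpow_natCast, ← Real.rpow_mul hx.le,
        div_eq_mul_inv, ← Real.rpow_neg (by norm_num)]
      rw [show r ^ (-(2 * (n : ℝ) - α + 1)) = r ^ (((2 : ℕ) : ℝ) * (-((n : ℝ) - α / 2) - 1) + 1) by
        congr 1; push_cast; ring, Real.rpow_add hx, Real.rpow_one]
      rw [show -(-((n : ℝ) - α / 2) - 1) = (n : ℝ) - α / 2 + 1 by ring]
      ring
    have e2 : d ^ n * d ^ n * d = d ^ α * d ^ (2 * (n : ℝ) - α + 1) := by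
      rw [← Real.rpow_add hd, show α + (2 * (n : ℝ) - α + 1) = (n : ℝ) + n + 1 by ring,
        Real.rpow_add hd, Real.rpow_add hd, Real.rpow_one, Real.rpow_natCast]
    have e3 : (d / r) ^ (2 * (n : ℝ) - α + 1) = d ^ (2 * (n : ℝ) - α + 1) * r ^ (-(2 * (n : ℝ) - α + 1)) := by
      rw [Real.div_rpow hd.le hx.le, Real.rpow_neg hx.le]; rfl
    calc _ = 2 * ((n : ℝ) - α / 2) * Real.sqrt n * (5 / 4) * (F * G) *
          ((r ^ 2 / 4) ^ (-((n : ℝ) - α / 2) - 1) * r) * (d ^ n * d ^ n * d) := by ring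
      _ = K1 * (F * G * d ^ α * (d / r) ^ (2 * (n : ℝ) - α + 1)) := by
          rw [e1, e2, e3, hK1]; ring
      _ ≤ (K1 + K2) * (F * G * d ^ α * (d / r) ^ (2 * (n : ℝ) - α + 1)) := by gcongr; linarith
      _ = _ := by ring
  · refine (Iop_near hn hα0 hα hd hG h hf0 hfM).trans ?_
    rw [← hW]
    have e1 : ((2 * Real.sqrt n * d) ^ (α / 2)) ^ 2 = (2 * Real.sqrt n) ^ α * d ^ α := by
      rw [← Real.mul_rpow (by positivity) hd.le, ← Real.rpow_natCast, ← Real.rpow_mul (by positivity)]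
      congr 1; push_cast; ring
    have e2 : 1 ≤ Real.sqrt n ^ (2 * (n : ℝ) - α + 1) * (d / r) ^ (2 * (n : ℝ) - α + 1) := by
      rw [← Real.mul_rpow (by positivity) (by positivity)]
      refine Real.one_le_rpow ?_ (by linarith)
      rw [← mul_div_assoc, le_div_iff₀ hx, one_mul]; exact h
    calc _ = 2 * F * G * W ^ 2 * ((2 * Real.sqrt n * d) ^ (α / 2)) ^ 2 * 1 := by ring
      _ ≤ 2 * F * G * W ^ 2 * ((2 * Real.sqrt n * d) ^ (α / 2)) ^ 2 *
          (Real.sqrt n ^ (2 * (n : ℝ) - α + 1) * (d / r) ^ (2 * (n : ℝ) - α + 1)) := by gcongr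
      _ = K2 * (F * G * d ^ α * (d / r) ^ (2 * (n : ℝ) - α + 1)) := by rw [e1, hK2]; ring
      _ ≤ (K1 + K2) * (F * G * d ^ α * (d / r) ^ (2 * (n : ℝ) - α + 1)) := by gcongr; linarith
      _ = _ := by ring

end JN

namespace JN

variable {n : ℕ}

lemma term_bound {q α C B : ℝ} (hq' : 1 < q) (hα : α < 2 * n) (hC : 0 ≤ C) (hB : 0 ≤ B)
    {b I : Rn n → ℝ} {a : ℝ} {c : Rn n} {d : ℝ} (hd : 0 < d)
    (hI : ∀ x, 0 < ‖x - c‖ → |I x| ≤ C * d ^ (-((n : ℝ) / q)) * (d / ‖x - c‖) ^ (2 * (n : ℝ) - α + 1))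
    (hBb : ∀ ρ : ℝ, 1 ≤ ρ → ∫⁻ x in cube n c (ρ * d), ENNReal.ofReal (|b x - a| ^ q) ≤
      ENNReal.ofReal (B * ρ ^ (q / 2) * (ρ * d) ^ n)) {t : ℝ} (ht : 1 ≤ t) :
    ∫⁻ x in {x : Rn n | t * d < ‖x - c‖ ∧ ‖x - c‖ ≤ 2 * t * d}, ENNReal.ofReal (|(b x - a) * I x| ^ q) ≤
      ENNReal.ofReal (C ^ q * B * 4 ^ (q / 2) * 4 ^ n *
        t ^ (-(q * (2 * (n : ℝ) - α - n / q + 1 / 2)))) := by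
  have ht0 : 0 < t := by linarith
  have hq0 : 0 < q := by linarith
  set S := 2 * (n : ℝ) - α + 1 with hS
  have hS0 : 0 < S := by rw [hS]; linarith
  set K := (C * d ^ (-((n : ℝ) / q)) * t ^ (-S)) ^ q with hK
  have hK0 : 0 ≤ K := by positivity
  have hmeas : MeasurableSet {x : Rn n | t * d < ‖x - c‖ ∧ ‖x - c‖ ≤ 2 * t * d} :=
    (measurableSet_lt (f := fun _ : Rn n => t * d) (g := fun x : Rn n => ‖x - c‖)
      (by fun_prop) (by fun_prop)).inter
    (measurableSet_le (f := fun x : Rn n => ‖x - c‖) (g := fun _ : Rn n => 2 * t * d)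
      (by fun_prop) (by fun_prop))
  calc _ ≤ ∫⁻ x in {x : Rn n | t * d < ‖x - c‖ ∧ ‖x - c‖ ≤ 2 * t * d},
        ENNReal.ofReal K * ENNReal.ofReal (|b x - a| ^ q) := by
        refine setLIntegral_mono' hmeas fun x hx => ?_
        have htd : 0 < t * d := by positivity
        have hr : 0 < ‖x - c‖ := htd.trans hx.1
        rw [← ENNReal.ofReal_mul hK0]
        refine ENNReal.ofReal_le_ofReal ?_
        rw [abs_mul, Real.mul_rpow (abs_nonneg _) (abs_nonneg _), mul_comm]
        refine mul_le_mul_of_nonneg_right ?_ (by positivity)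
        refine Real.rpow_le_rpow (abs_nonneg _) ((hI x hr).trans ?_) hq0.le
        refine mul_le_mul_of_nonneg_left ?_ (by positivity)
        rw [Real.rpow_neg ht0.le, ← Real.inv_rpow ht0.le]
        refine Real.rpow_le_rpow (by positivity) ?_ hS0.le
        rw [div_le_iff₀ hr, inv_mul_eq_div, le_div_iff₀ ht0, mul_comm]
        exact hx.1.le
    _ ≤ ENNReal.ofReal K * ∫⁻ x in cube n c (4 * t * d), ENNReal.ofReal (|b x - a| ^ q) := by
        rw [lintegral_const_mul' _ _ ENNReal.ofReal_ne_top]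
        gcongr
        intro x hx i
        have h1 : ‖(x - c) i‖ ≤ ‖x - c‖ := PiLp.norm_apply_le (x - c) i
        have h2 := hx.2
        have h3 : |x i - c i| ≤ ‖x - c‖ := h1
        linarith
    _ ≤ ENNReal.ofReal K * ENNReal.ofReal (B * (4 * t) ^ (q / 2) * (4 * t * d) ^ n) := by
        gcongr
        exact hBb (4 * t) (by linarith)
    _ = _ := by
        rw [← ENNReal.ofReal_mul hK0]
        congr 1
        rw [hK, Real.mul_rpow (by positivity) (by positivity), Real.mul_rpow hC (by positivity),
          ← Real.rpow_mul hd.le, ← Real.rpow_mul ht0.le, Real.mul_rpow (by norm_num) ht0.le, mul_pow, mul_pow]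
        have e1 : d ^ (-((n : ℝ) / q) * q) * d ^ n = 1 := by
          rw [← Real.rpow_natCast d n, ← Real.rpow_add hd, neg_mul, div_mul_cancel₀ _ hq0.ne']; simp
        have e2 : t ^ (-(q * (2 * (n : ℝ) - α - n / q + 1 / 2))) = t ^ (-S * q) * t ^ (q / 2) * t ^ n := by
          rw [← Real.rpow_natCast t n, ← Real.rpow_add ht0, ← Real.rpow_add ht0]
          congr 1
          rw [hS]; field_simp; ring
        rw [e2]
        linear_combination (C ^ q * t ^ (-S * q) * B * 4 ^ (q / 2) * t ^ (q / 2) * 4 ^ n * t ^ n) * e1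

lemma tail_bound {q σ D : ℝ} (hq' : 1 < q) (hσ : 0 < σ) (hD : 0 ≤ D) {c : Rn n} {d γ : ℝ} (hd : 0 < d)
    (hγ : 1 ≤ γ) {Φ : Rn n → ℝ≥0∞}
    (h : ∀ t, 1 ≤ t → ∫⁻ x in {x : Rn n | t * d < ‖x - c‖ ∧ ‖x - c‖ ≤ 2 * t * d}, Φ x ≤
      ENNReal.ofReal (D * t ^ (-(q * σ)))) :
    (∫⁻ x in {x : Rn n | γ * d < ‖x - c‖}, Φ x) ^ (1 / q) ≤
      ENNReal.ofReal ((D * (1 - 2 ^ (-(q * σ)))⁻¹) ^ (1 / q) * γ ^ (-σ)) := by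
  have hq0 : 0 < q := by linarith
  have hγ0 : 0 < γ := by linarith
  set ρ : ℝ := 2 ^ (-(q * σ)) with hρ
  have hρ0 : 0 ≤ ρ := by positivity
  have hρ1 : ρ < 1 := Real.rpow_lt_one_of_one_lt_of_neg (by norm_num) (by nlinarith)
  have hsub : {x : Rn n | γ * d < ‖x - c‖} ⊆ ⋃ k : ℕ,
      {x : Rn n | (2 ^ k * γ) * d < ‖x - c‖ ∧ ‖x - c‖ ≤ 2 * (2 ^ k * γ) * d} := by
    intro x hx
    have hx : γ * d < ‖x - c‖ := hx
    have hgd : 0 < γ * d := by positivity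
    obtain ⟨k, hk⟩ := pow_unbounded_of_one_lt (‖x - c‖ / (γ * d)) (one_lt_two)
    have hk' : ‖x - c‖ ≤ 2 ^ k * (γ * d) := by
      rw [div_lt_iff₀ hgd] at hk; exact hk.le
    have hex : ∃ k : ℕ, ‖x - c‖ ≤ 2 ^ k * (γ * d) := ⟨k, hk'⟩
    classical
    have hs := Nat.find_spec hex
    have hm : ∀ m, m < Nat.find hex → ¬ (‖x - c‖ ≤ 2 ^ m * (γ * d)) := fun m => Nat.find_min hex
    generalize Nat.find hex = m at hs hm
    rcases m with _ | m
    · simp at hs; linarith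
    · refine mem_iUnion.2 ⟨m, ?_, ?_⟩
      · have := hm m (Nat.lt_succ_self m)
        push Not at this
        linarith
      · rw [pow_succ] at hs; linarith
  have hterm : ∀ k : ℕ, ∫⁻ x in {x : Rn n | (2 ^ k * γ) * d < ‖x - c‖ ∧ ‖x - c‖ ≤ 2 * (2 ^ k * γ) * d}, Φ x ≤
      ENNReal.ofReal (D * γ ^ (-(q * σ)) * ρ ^ k) := by
    intro k
    have h1 : (1 : ℝ) ≤ 2 ^ k := one_le_pow₀ (by norm_num)
    refine (h (2 ^ k * γ) (by nlinarith)).trans (le_of_eq ?_)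
    congr 1
    rw [Real.mul_rpow (by positivity) hγ0.le, hρ, ← Real.rpow_natCast 2 k,
      ← Real.rpow_natCast (2 ^ (-(q * σ)) : ℝ) k,
      ← Real.rpow_mul (by norm_num), ← Real.rpow_mul (by norm_num), mul_comm (k : ℝ)]
    ring
  have hsum : ∫⁻ x in {x : Rn n | γ * d < ‖x - c‖}, Φ x ≤
      ENNReal.ofReal (D * γ ^ (-(q * σ)) * (1 - ρ)⁻¹) := by
    calc _ ≤ ∫⁻ x in ⋃ k : ℕ, {x : Rn n | (2 ^ k * γ) * d < ‖x - c‖ ∧ ‖x - c‖ ≤ 2 * (2 ^ k * γ) * d}, Φ x :=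
          lintegral_mono_set hsub
      _ ≤ ∑' k : ℕ, ∫⁻ x in {x : Rn n | (2 ^ k * γ) * d < ‖x - c‖ ∧ ‖x - c‖ ≤ 2 * (2 ^ k * γ) * d}, Φ x :=
          lintegral_iUnion_le _ _
      _ ≤ ∑' k : ℕ, ENNReal.ofReal (D * γ ^ (-(q * σ)) * ρ ^ k) := ENNReal.tsum_le_tsum hterm
      _ = _ := by
          rw [← ENNReal.ofReal_tsum_of_nonneg (fun k => by positivity)
            ((summable_geometric_of_lt_one hρ0 hρ1).mul_left _), tsum_mul_left,
            tsum_geometric_of_lt_one hρ0 hρ1]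
  have h1ρ : 0 < 1 - ρ := by linarith
  refine (ENNReal.rpow_le_rpow hsum (by positivity)).trans (le_of_eq ?_)
  rw [ENNReal.ofReal_rpow_of_nonneg (by positivity) (by positivity)]
  congr 1
  rw [show D * γ ^ (-(q * σ)) * (1 - ρ)⁻¹ = (D * (1 - ρ)⁻¹) * γ ^ (-(q * σ)) by ring,
    Real.mul_rpow (by positivity) (by positivity), ← Real.rpow_mul hγ0.le]
  congr 2
  field_simp

end JN

/-- (Tail estimate for `(b-b_{Q_j}) I_α(f_j,g_j)`, Estimate (13).) There is
`C`, independent of `b` and the cube, such that for every `γ̃₁ > 16`,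
`(∫_{|x-y_j|>γ̃₁ d_j} |(b(x)-b_{Q_j}) I_α(f_j,g_j)(x)|^q dx)^{1/q} ≤
  C γ̃₁^{-(2n-α-n/q+1/2)}`. -/
theorem statement14 (n : ℕ) (hn : 0 < n) (p₁ p₂ q α : ℝ)
    (hp₁ : 1 < p₁) (hp₂ : 1 < p₂)
    (hα₀ : 0 < α) (hα₂ : α < 2 * n)
    (hαp : α / n < 1 / p₁ + 1 / p₂) (hsum : 1 / p₁ + 1 / p₂ < 2)
    (hq : 1 / q = 1 / p₁ + 1 / p₂ - α / n) (hq' : 1 < q) :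
    ∃ C : ℝ, ∀ b : Rn n → ℝ, LocallyIntegrable b volume → bmoNorm n b = 1 →
      ∀ (yj : Rn n) (dj : ℝ), 0 < dj →
        ∀ γ : ℝ, 16 < γ →
          (∫⁻ x in {x : Rn n | γ * dj < ‖x - yj‖},
              ENNReal.ofReal
                (|(b x - cubeAvg n b yj dj) *
                    Iop n α (testF n p₁ b yj dj) (testG n p₂ yj dj) x| ^ q)) ^ (1 / q)
            ≤ ENNReal.ofReal (C * γ ^ (-(2 * (n : ℝ) - α - n / q + 1 / 2))) := by
  have hn' : (0 : ℝ) < n := by exact_mod_cast hn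
  have hq0 : 0 < q := by linarith
  obtain ⟨C, hC, hA⟩ := JN.lemA hn (p₁ := p₁) (p₂ := p₂) hα₀ hα₂ hq
  obtain ⟨B, hB, hBb⟩ := JN.lemB n hq0
  have hnq : (n : ℝ) / q = n * (1 / p₁ + 1 / p₂) - α := by
    rw [div_eq_mul_one_div, hq]; field_simp
  have hσ : 0 < 2 * (n : ℝ) - α - n / q + 1 / 2 := by
    rw [hnq]; nlinarith
  refine ⟨((C ^ q * B * 4 ^ (q / 2) * 4 ^ n) *
    (1 - 2 ^ (-(q * (2 * (n : ℝ) - α - n / q + 1 / 2))))⁻¹) ^ (1 / q), fun b hb hb1 yj dj hd γ hγ => ?_⟩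
  exact JN.tail_bound hq' hσ (D := C ^ q * B * 4 ^ (q / 2) * 4 ^ n) (by positivity) hd (by linarith)
    (fun t ht => JN.term_bound hq' hα₂ hC hB hd (hA b hb yj dj hd) (hBb b hb hb1 yj dj hd) ht)
end

section
/- Let 1<p₁,p₂<∞, 0<α<2n, α/n < 1/p₁ + 1/p₂ < 2, 1/q = 1/p₁ + 1/p₂ − α/n with 1<q<∞, and let ε>0. Then there exist constants γ₂ > γ₁ > 2 and γ₃ > 0, depending only on p₁, p₂, n, α, q, and ε, such that for every real-valued b with ‖b‖_{BMO} = 1 and every cube Q_j with center y_j and side length d_j satisfying ⨍_{Q_j}|b − b_{Q_j}| ≥ ε, the associated test functions f_j, g_j satisfy both (∫_{γ₁d_j < |x−y_j| < γ₂d_j} |[b,I_α]₁(f_j,g_j)(x)|^q dx)^{1/q} ≥ γ₃ and (∫_{|x−y_j| > γ₂d_j} |[b,I_α]₁(f_j,g_j)(x)|^q dx)^{1/q} ≤ γ₃/4. -/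
open MeasureTheory Set Filter
open scoped ENNReal BigOperators Topology

section JN

open Metric

/-- ball averages on `Fin n → ℝ` -/
noncomputable def JNav {n : ℕ} (b : (Fin n → ℝ) → ℝ) (c : Fin n → ℝ) (R : ℝ) : ℝ :=
  ⨍ x in closedBall c R, b x

/-- bmo-type hypothesis on `Fin n → ℝ` -/
noncomputable def JNhyp {n : ℕ} (b : (Fin n → ℝ) → ℝ) : Prop :=
  ∀ (c : Fin n → ℝ) (R : ℝ), 0 < R →
    ∫⁻ x in closedBall c R, ‖b x - JNav b c R‖ₑ ≤ volume (closedBall c R)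

lemma JN_vol {n : ℕ} (c : Fin n → ℝ) {R : ℝ} (hR : 0 < R) :
    volume (closedBall c R) = ENNReal.ofReal ((2 * R) ^ n) := by
  rw [Real.volume_pi_closedBall _ hR.le, Fintype.card_fin]

lemma JN_av_sub {n : ℕ} {b : (Fin n → ℝ) → ℝ} (hb : LocallyIntegrable b volume)
    (x : Fin n → ℝ) {r : ℝ} (hr : 0 < r) (β : ℝ) :
    ENNReal.ofReal |JNav b x r - β| * volume (closedBall x r) ≤
      ∫⁻ y in closedBall x r, ‖b y - β‖ₑ := by
  have hV : 0 < (2 * r) ^ n := by positivity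
  have hreal : volume.real (closedBall x r) = (2 * r) ^ n := by
    rw [Measure.real, JN_vol x hr, ENNReal.toReal_ofReal hV.le]
  have hint : IntegrableOn b (closedBall x r) volume :=
    hb.integrableOn_isCompact (isCompact_closedBall x r)
  have h1 : ∫ y in closedBall x r, (b y - β) = (JNav b x r - β) * (2 * r) ^ n := by
    rw [integral_sub hint (integrableOn_const (by rw [JN_vol x hr]; exact ENNReal.ofReal_ne_top))]
    rw [setIntegral_const, JNav, setAverage_eq, hreal]
    simp only [smul_eq_mul]
    field_simp
  have h2 := enorm_integral_le_lintegral_enorm (μ := volume.restrict (closedBall x r))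
    (fun y => b y - β)
  rw [h1] at h2
  refine le_trans (le_of_eq ?_) h2
  rw [JN_vol x hr, ← ENNReal.ofReal_mul (abs_nonneg _), Real.enorm_eq_ofReal_abs, abs_mul,
    abs_of_pos hV]

lemma JN_av_cmp {n : ℕ} {b : (Fin n → ℝ) → ℝ} (hb : LocallyIntegrable b volume)
    (hB : JNhyp b) {x c : Fin n → ℝ} {r R t : ℝ} (hr : 0 < r) (hR : 0 < R)
    (hsub : closedBall x r ⊆ closedBall c R) (ht : R ≤ t * r) :
    |JNav b x r - JNav b c R| ≤ t ^ n := by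
  have hV : 0 < (2 * r) ^ n := by positivity
  have htp : 0 < t := by
    by_contra h
    push Not at h
    nlinarith
  have h1 := (JN_av_sub hb x hr (JNav b c R)).trans
    ((lintegral_mono_set hsub).trans (hB c R hR))
  rw [JN_vol x hr, JN_vol c hR, ← ENNReal.ofReal_mul (abs_nonneg _),
    ENNReal.ofReal_le_ofReal_iff (by positivity)] at h1
  have h2 : (2 * R) ^ n ≤ t ^ n * (2 * r) ^ n := by
    rw [← mul_pow]
    exact pow_le_pow_left₀ (by positivity) (by linarith) n
  exact le_of_mul_le_mul_right (h1.trans h2) hV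

/-- stopping constant -/
noncomputable def JNL (n : ℕ) : ℝ := 2 * 5 ^ n * ((1 + 2 ^ n) * 2 ^ n)

noncomputable def JNA (n : ℕ) : ℝ := JNL n + 2 ^ n + 5 ^ n

lemma JNL_pos (n : ℕ) : 0 < JNL n := by unfold JNL; positivity

lemma JNA_pos (n : ℕ) : 0 < JNA n := by
  have := JNL_pos n
  unfold JNA; positivity

lemma JNL_ge (n : ℕ) : 2 * 2 ^ n ≤ JNL n := by
  unfold JNL
  have h1 : (1 : ℝ) ≤ 5 ^ n := one_le_pow₀ (by norm_num)
  have h2 : (1 : ℝ) ≤ 2 ^ n := one_le_pow₀ (by norm_num)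
  have h3 : (2:ℝ) ^ n ≤ (1 + 2 ^ n) * 2 ^ n := by nlinarith
  nlinarith

lemma JN_radius {n : ℕ} {b : (Fin n → ℝ) → ℝ} (hb : LocallyIntegrable b volume)
    (hB : JNhyp b) {c : Fin n → ℝ} {R : ℝ} (hR : 0 < R) {x : Fin n → ℝ}
    (hx : x ∈ closedBall c R) (hbx : JNL n < |b x - JNav b c R|)
    (hlim : Tendsto (fun j : ℕ => JNav b x (R * (1 / 2) ^ j)) atTop (𝓝 (b x))) :
    ∃ r : ℝ, 0 < r ∧ r ≤ R ∧ JNL n < |JNav b x r - JNav b c R| ∧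
      |JNav b x r - JNav b c R| ≤ JNL n + 2 ^ n := by
  classical
  have hlim2 : Tendsto (fun j : ℕ => |JNav b x (R * (1 / 2) ^ j) - JNav b c R|) atTop
      (𝓝 |b x - JNav b c R|) := (hlim.sub_const _).abs
  have hex : ∃ j : ℕ, JNL n < |JNav b x (R * (1 / 2) ^ j) - JNav b c R| :=
    (hlim2.eventually (lt_mem_nhds hbx)).exists
  have hj := Nat.find_spec hex
  have hmin := fun m => Nat.find_min hex (m := m)
  set j := Nat.find hex with hjdef
  have hxc : dist x c ≤ R := hx
  have h0 : |JNav b x R - JNav b c R| ≤ JNL n := by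
    have e1 : |JNav b x R - JNav b c (2 * R)| ≤ 2 ^ n :=
      JN_av_cmp hb hB hR (by positivity) (closedBall_subset_closedBall' (by linarith)) le_rfl
    have e2 : |JNav b c R - JNav b c (2 * R)| ≤ 2 ^ n :=
      JN_av_cmp hb hB hR (by positivity) (closedBall_subset_closedBall (by linarith)) le_rfl
    have := JNL_ge n
    rw [abs_le] at *
    constructor <;> linarith [e1.1, e1.2, e2.1, e2.2]
  have hj0 : j ≠ 0 := by
    intro h
    rw [h] at hj
    simp only [pow_zero, mul_one] at hj
    linarith
  obtain ⟨m, hm⟩ := Nat.exists_eq_succ_of_ne_zero hj0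
  refine ⟨R * (1 / 2) ^ j, by positivity, ?_, hj, ?_⟩
  · have : ((1:ℝ) / 2) ^ j ≤ 1 := pow_le_one₀ (by norm_num) (by norm_num)
    nlinarith
  · have h3 := hmin m (by omega)
    push Not at h3
    have h4 : |JNav b x (R * (1 / 2) ^ j) - JNav b x (R * (1 / 2) ^ m)| ≤ 2 ^ n := by
      have e : R * (1 / 2) ^ m = 2 * (R * (1 / 2) ^ j) := by
        rw [hm, pow_succ]; ring
      have hp : 0 < R * (1 / 2) ^ j := by positivity
      refine JN_av_cmp hb hB hp (by positivity) (closedBall_subset_closedBall ?_) e.le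
      rw [e]; linarith
    have := abs_sub_le (JNav b x (R * (1 / 2) ^ j)) (JNav b x (R * (1 / 2) ^ m)) (JNav b c R)
    linarith

lemma JN_ae_lim {n : ℕ} {b : (Fin n → ℝ) → ℝ} (hb : LocallyIntegrable b volume)
    {R : ℝ} (hR : 0 < R) :
    ∀ᵐ x, Tendsto (fun j : ℕ => JNav b x (R * (1 / 2) ^ j)) atTop (𝓝 (b x)) := by
  filter_upwards [IsUnifLocDoublingMeasure.ae_tendsto_average volume hb 1] with x hx
  refine hx (fun _ => x) (fun j : ℕ => R * (1 / 2) ^ j) ?_ ?_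
  · refine tendsto_nhdsWithin_iff.2 ⟨?_, ?_⟩
    · simpa using (tendsto_pow_atTop_nhds_zero_of_lt_one (r := (1 / 2 : ℝ)) (by norm_num)
        (by norm_num)).const_mul R
    · exact Eventually.of_forall fun j => by
        simp only [mem_Ioi]; positivity
  · exact Eventually.of_forall fun j => mem_closedBall_self (by positivity)

lemma JN_mass {n : ℕ} {b : (Fin n → ℝ) → ℝ} (hb : LocallyIntegrable b volume)
    (hB : JNhyp b) (c : Fin n → ℝ) {R : ℝ} (hR : 0 < R) :
    ∫⁻ x in closedBall c (2 * R), ‖b x - JNav b c R‖ₑ ≤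
      ENNReal.ofReal ((1 + 2 ^ n) * 2 ^ n) * volume (closedBall c R) := by
  have e2 : |JNav b c R - JNav b c (2 * R)| ≤ 2 ^ n :=
      JN_av_cmp hb hB hR (by positivity) (closedBall_subset_closedBall (by linarith)) le_rfl
  have hpt : ∀ x, ‖b x - JNav b c R‖ₑ ≤ ‖b x - JNav b c (2 * R)‖ₑ + ENNReal.ofReal (2 ^ n) := by
    intro x
    rw [Real.enorm_eq_ofReal_abs, Real.enorm_eq_ofReal_abs,
      ← ENNReal.ofReal_add (abs_nonneg _) (by positivity)]
    apply ENNReal.ofReal_le_ofReal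
    have := abs_sub_le (b x) (JNav b c (2 * R)) (JNav b c R)
    rw [abs_sub_comm (JNav b c (2 * R))] at this
    linarith
  have h2R : 0 < 2 * R := by positivity
  calc _ ≤ ∫⁻ x in closedBall c (2 * R), (‖b x - JNav b c (2 * R)‖ₑ + ENNReal.ofReal (2 ^ n)) :=
        lintegral_mono hpt
    _ = (∫⁻ x in closedBall c (2 * R), ‖b x - JNav b c (2 * R)‖ₑ)
        + ENNReal.ofReal (2 ^ n) * volume (closedBall c (2 * R)) := by
        rw [lintegral_add_right _ measurable_const, setLIntegral_const]
    _ ≤ volume (closedBall c (2 * R)) + ENNReal.ofReal (2 ^ n) * volume (closedBall c (2 * R)) := by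
        gcongr; exact hB c _ h2R
    _ = _ := by
        rw [JN_vol c h2R, JN_vol c hR, ← ENNReal.ofReal_mul (by positivity),
          ← ENNReal.ofReal_add (by positivity) (by positivity),
          ← ENNReal.ofReal_mul (by positivity)]
        congr 1
        rw [mul_pow 2 (2 * R)]
        ring

lemma JN_decay {n : ℕ} {b : (Fin n → ℝ) → ℝ} (hb : LocallyIntegrable b volume)
    (hB : JNhyp b) (k : ℕ) : ∀ (c : Fin n → ℝ) (R : ℝ), 0 < R →
      volume {x | x ∈ closedBall c R ∧ k * JNA n < |b x - JNav b c R|} ≤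
        ENNReal.ofReal ((1 / 2) ^ k) * volume (closedBall c R) := by
  induction k with
  | zero =>
    intro c R hR
    simp only [pow_zero, ENNReal.ofReal_one, one_mul]
    exact measure_mono fun x hx => hx.1
  | succ k ih =>
    intro c R hR
    have hLp := JNL_pos n
    have hAp := JNA_pos n
    have hLA : JNL n ≤ JNA n := by unfold JNA; have : (0:ℝ) < 2 ^ n := by positivity
                                   have : (0:ℝ) < 5 ^ n := by positivity
                                   linarith
    set E := {x | x ∈ closedBall c R ∧ ((k + 1 : ℕ) : ℝ) * JNA n < |b x - JNav b c R|} with hE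
    set N := {x | ¬ Tendsto (fun j : ℕ => JNav b x (R * (1 / 2) ^ j)) atTop (𝓝 (b x))} with hN
    have hN0 : volume N = 0 := JN_ae_lim hb hR
    have hradius : ∀ x ∈ E \ N, ∃ r : ℝ, 0 < r ∧ r ≤ R ∧ JNL n < |JNav b x r - JNav b c R| ∧
      |JNav b x r - JNav b c R| ≤ JNL n + 2 ^ n := by
      rintro x ⟨hx, hxN⟩
      refine JN_radius hb hB hR hx.1 ?_ (by simpa [hN] using hxN)
      refine lt_of_le_of_lt ?_ hx.2
      push_cast
      have : (0:ℝ) ≤ k * JNA n := by positivity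
      linarith
    choose! r hr0 hrR hrL hrU using hradius
    obtain ⟨u, hut, hdisj, hcov⟩ := Vitali.exists_disjoint_subfamily_covering_enlargement_closedBall
      (E \ N) (fun x => x) r R hrR 5 (by norm_num)
    have hcount : u.Countable := hdisj.countable_of_nonempty_interior fun x hx =>
      ⟨x, ball_subset_interior_closedBall (mem_ball_self (hr0 x (hut hx)))⟩
    have hsub : E ⊆ N ∪ ⋃ x ∈ u, {y | y ∈ closedBall x (5 * r x) ∧
        k * JNA n < |b y - JNav b x (5 * r x)|} := by
      intro y hy
      by_cases hyN : y ∈ N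
      · exact Or.inl hyN
      right
      obtain ⟨x, hxu, hx⟩ := hcov y ⟨hy, hyN⟩
      have hrx := hr0 x (hut hxu)
      refine mem_biUnion hxu ⟨hx (mem_closedBall_self (hr0 y ⟨hy, hyN⟩).le), ?_⟩
      have h1 : |JNav b x (r x) - JNav b x (5 * r x)| ≤ 5 ^ n :=
        JN_av_cmp hb hB hrx (by positivity) (closedBall_subset_closedBall (by linarith)) le_rfl
      have h2 := hrU x (hut hxu)
      have h3 := hy.2
      push_cast at h3
      have h4 := abs_sub_le (b y) (JNav b x (5 * r x)) (JNav b c R)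
      have h5 := abs_sub_le (JNav b x (5 * r x)) (JNav b x (r x)) (JNav b c R)
      rw [abs_sub_comm (JNav b x (5 * r x)) (JNav b x (r x))] at h5
      have h6 : JNA n = JNL n + 2 ^ n + 5 ^ n := rfl
      nlinarith
    have hsum : ENNReal.ofReal (JNL n) * ∑' x : u, volume (closedBall (x : Fin n → ℝ) (r x)) ≤
        ENNReal.ofReal ((1 + 2 ^ n) * 2 ^ n) * volume (closedBall c R) := by
      refine le_trans ?_ (JN_mass hb hB c hR)
      rw [← ENNReal.tsum_mul_left]
      calc _ ≤ ∑' x : u, ∫⁻ y in closedBall (x : Fin n → ℝ) (r x), ‖b y - JNav b c R‖ₑ := by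
            refine ENNReal.tsum_le_tsum fun x => ?_
            refine le_trans ?_ (JN_av_sub hb (x : Fin n → ℝ) (hr0 x (hut x.2)) (JNav b c R))
            gcongr
            exact (hrL x (hut x.2)).le
        _ = ∫⁻ y in ⋃ x ∈ u, closedBall x (r x), ‖b y - JNav b c R‖ₑ := by
            rw [lintegral_biUnion hcount (fun x _ => measurableSet_closedBall) hdisj]
        _ ≤ _ := by
            refine lintegral_mono_set (iUnion₂_subset fun x hx => ?_)
            have : dist x c ≤ R := (hut hx).1.1
            have := hrR x (hut hx)
            exact closedBall_subset_closedBall' (by linarith)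
    calc volume E ≤ volume N + volume (⋃ x ∈ u, {y | y ∈ closedBall x (5 * r x) ∧
        k * JNA n < |b y - JNav b x (5 * r x)|}) := (measure_mono hsub).trans (measure_union_le _ _)
      _ ≤ ∑' x : u, volume {y | y ∈ closedBall (x : Fin n → ℝ) (5 * r x) ∧
        k * JNA n < |b y - JNav b x (5 * r x)|} := by
          rw [hN0, zero_add]; exact measure_biUnion_le _ hcount _
      _ ≤ ∑' x : u, ENNReal.ofReal ((1 / 2) ^ k * 5 ^ n) *
            volume (closedBall (x : Fin n → ℝ) (r x)) := by
          refine ENNReal.tsum_le_tsum fun x => ?_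
          have hrx := hr0 x (hut x.2)
          refine (ih x (5 * r x) (by positivity)).trans (le_of_eq ?_)
          rw [JN_vol _ (by positivity), JN_vol _ hrx, ← ENNReal.ofReal_mul (by positivity),
            ← ENNReal.ofReal_mul (by positivity)]
          congr 1
          rw [show 2 * (5 * r x) = 5 * (2 * r x) by ring, mul_pow 5]
          ring
      _ = ENNReal.ofReal ((1 / 2) ^ k * 5 ^ n / JNL n) * (ENNReal.ofReal (JNL n) *
            ∑' x : u, volume (closedBall (x : Fin n → ℝ) (r x))) := by
          rw [ENNReal.tsum_mul_left, ← mul_assoc, ← ENNReal.ofReal_mul (by positivity)]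
          congr 2
          field_simp
      _ ≤ ENNReal.ofReal ((1 / 2) ^ k * 5 ^ n / JNL n) *
            (ENNReal.ofReal ((1 + 2 ^ n) * 2 ^ n) * volume (closedBall c R)) := by gcongr
      _ = _ := by
          rw [← mul_assoc, ← ENNReal.ofReal_mul (by positivity)]
          congr 2
          unfold JNL
          rw [pow_succ]
          field_simp

lemma geom_sum_finite (A δ q : ℝ) (hA : 0 < A) (hδ : 0 < δ) (hδ1 : δ < 1) :
    ∑' k : ℕ, ENNReal.ofReal (((k + 1) * A) ^ q * δ ^ k) < ⊤ := by
  have hs : Summable fun k : ℕ => ((k + 1 : ℝ) * A) ^ q * δ ^ k := by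
    obtain ⟨N, hN⟩ := exists_nat_ge q
    have h1 : Summable fun k : ℕ => ((k : ℝ) ^ N * δ ^ k) :=
      summable_pow_mul_geometric_of_norm_lt_one N (by rwa [Real.norm_of_nonneg hδ.le])
    have h2 : Summable fun k : ℕ => A ^ q * δ⁻¹ * ((k + 1 : ℕ) : ℝ) ^ N * δ ^ (k + 1) := by
      have := ((summable_nat_add_iff 1).2 h1).mul_left (A ^ q * δ⁻¹)
      simpa [mul_assoc] using this
    refine Summable.of_nonneg_of_le (fun k => by positivity) (fun k => ?_) h2
    rw [Real.mul_rpow (by positivity) hA.le]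
    have h3 : ((k : ℝ) + 1) ^ q ≤ ((k + 1 : ℕ) : ℝ) ^ N := by
      rw [← Real.rpow_natCast]
      push_cast
      exact Real.rpow_le_rpow_of_exponent_le (by linarith [(Nat.cast_nonneg k : (0:ℝ) ≤ k)]) hN
    have h4 : A ^ q * δ⁻¹ * ((k + 1 : ℕ) : ℝ) ^ N * δ ^ (k + 1) =
        ((k + 1 : ℕ) : ℝ) ^ N * A ^ q * δ ^ k := by
      rw [pow_succ]; field_simp
    rw [h4]
    gcongr
  rw [← ENNReal.ofReal_tsum_of_nonneg (fun k => by positivity) hs]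
  exact ENNReal.ofReal_lt_top

lemma JN_Lq (n : ℕ) (q : ℝ) (hq : 0 < q) : ∃ C : ℝ, 0 < C ∧
    ∀ b : (Fin n → ℝ) → ℝ, LocallyIntegrable b volume → JNhyp b →
      ∀ (c : Fin n → ℝ) (R : ℝ), 0 < R →
        ∫⁻ x in closedBall c R, ENNReal.ofReal (|b x - JNav b c R| ^ q) ≤
          ENNReal.ofReal C * volume (closedBall c R) := by
  have hAp := JNA_pos n
  have hfin := geom_sum_finite (JNA n) (1 / 2) q hAp (by norm_num) (by norm_num)
  set T := ∑' k : ℕ, ENNReal.ofReal (((k + 1) * JNA n) ^ q * (1 / 2) ^ k) with hT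
  refine ⟨T.toReal + 1, by positivity, fun b hb hB c R hR => ?_⟩
  have hTle : T ≤ ENNReal.ofReal (T.toReal + 1) := by
    conv_lhs => rw [← ENNReal.ofReal_toReal hfin.ne]
    exact ENNReal.ofReal_le_ofReal (by linarith)
  set β := JNav b c R
  have hmeas : ∀ k : ℕ, NullMeasurableSet {x | (k : ℝ) * JNA n < |b x - β|}
      (volume.restrict (closedBall c R)) := by
    intro k
    have h1 : AEMeasurable (fun x => |b x - β|) (volume.restrict (closedBall c R)) := by
      have := (hb.aestronglyMeasurable.aemeasurable.restrict (s := closedBall c R)).sub_const β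
      exact continuous_abs.measurable.comp_aemeasurable this
    exact nullMeasurableSet_lt aemeasurable_const h1
  have hpt : ∀ x, ENNReal.ofReal (|b x - β| ^ q) ≤ ∑' k : ℕ,
      ({x | (k : ℝ) * JNA n < |b x - β|}).indicator
        (fun _ => ENNReal.ofReal (((k + 1) * JNA n) ^ q)) x := by
    intro x
    rcases eq_or_lt_of_le (abs_nonneg (b x - β)) with h0 | h0
    · rw [← h0, Real.zero_rpow hq.ne']; simp
    · set k := ⌈|b x - β| / JNA n⌉₊ - 1 with hk
      have hc : 0 < ⌈|b x - β| / JNA n⌉₊ := Nat.ceil_pos.2 (by positivity)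
      have hk1 : ⌈|b x - β| / JNA n⌉₊ = k + 1 := by omega
      have hk2 : (k : ℝ) * JNA n < |b x - β| := by
        have : (k : ℝ) < |b x - β| / JNA n := Nat.lt_ceil.1 (by omega)
        rwa [lt_div_iff₀ hAp] at this
      have hk3 : |b x - β| ≤ (k + 1) * JNA n := by
        have := Nat.le_ceil (|b x - β| / JNA n)
        rw [hk1, div_le_iff₀ hAp] at this
        exact_mod_cast this
      refine le_trans ?_ (ENNReal.le_tsum k)
      rw [indicator_of_mem (show x ∈ {x | (k : ℝ) * JNA n < |b x - β|} from hk2)]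
      gcongr
  calc _ ≤ ∫⁻ x in closedBall c R, ∑' k : ℕ,
      ({x | (k : ℝ) * JNA n < |b x - β|}).indicator
        (fun _ => ENNReal.ofReal (((k + 1) * JNA n) ^ q)) x := lintegral_mono hpt
    _ = ∑' k : ℕ, ∫⁻ x in closedBall c R,
      ({x | (k : ℝ) * JNA n < |b x - β|}).indicator
        (fun _ => ENNReal.ofReal (((k + 1) * JNA n) ^ q)) x :=
        lintegral_tsum fun k => (aemeasurable_const.indicator₀ (hmeas k))
    _ ≤ ∑' k : ℕ, ENNReal.ofReal (((k + 1) * JNA n) ^ q * (1 / 2) ^ k) *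
          volume (closedBall c R) := by
        refine ENNReal.tsum_le_tsum fun k => ?_
        rw [lintegral_indicator_const₀ (hmeas k), Measure.restrict_apply₀ (hmeas k),
          ENNReal.ofReal_mul (by positivity), mul_assoc]
        gcongr
        refine le_trans (measure_mono ?_) (JN_decay hb hB k c R hR)
        exact fun x hx => ⟨hx.2, hx.1⟩
    _ = T * volume (closedBall c R) := ENNReal.tsum_mul_right
    _ ≤ _ := by gcongr

end JN

section Transfer

open Metric

/-- the coordinate map -/
noncomputable def eRn (n : ℕ) : Rn n ≃ᵐ (Fin n → ℝ) := (MeasurableEquiv.toLp 2 (Fin n → ℝ)).symm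

lemma eRn_mp (n : ℕ) : MeasurePreserving (eRn n) volume volume :=
  EuclideanSpace.volume_preserving_symm_measurableEquiv_toLp (Fin n)

lemma cube_eq (n : ℕ) (c : Rn n) {d : ℝ} (hd : 0 < d) :
    cube n c d = eRn n ⁻¹' closedBall (eRn n c) (d / 2) := by
  ext x
  simp only [cube, mem_ofPred_eq, mem_preimage, mem_closedBall,
    dist_pi_le_iff (by positivity : 0 ≤ d / 2), Real.dist_eq]
  rfl

lemma vol_cube (n : ℕ) (c : Rn n) {d : ℝ} (hd : 0 < d) :
    volume (cube n c d) = ENNReal.ofReal (d ^ n) := by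
  rw [cube_eq n c hd, (eRn_mp n).measure_preimage_equiv, JN_vol _ (by positivity)]
  congr 2; ring

lemma volr_cube (n : ℕ) (c : Rn n) {d : ℝ} (hd : 0 < d) :
    volume.real (cube n c d) = d ^ n := by
  rw [Measure.real, vol_cube n c hd, ENNReal.toReal_ofReal (by positivity)]

lemma compact_cube (n : ℕ) (c : Rn n) {d : ℝ} (hd : 0 < d) : IsCompact (cube n c d) := by
  have : cube n c d = (WithLp.toLp 2) '' closedBall (eRn n c) (d / 2) := by
    rw [cube_eq n c hd]
    ext x
    constructor
    · intro hx; exact ⟨eRn n x, hx, rfl⟩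
    · rintro ⟨y, hy, rfl⟩; exact hy
  rw [this]
  exact (isCompact_closedBall _ _).image (PiLp.continuous_toLp 2 _)

lemma meas_cube (n : ℕ) (c : Rn n) {d : ℝ} (hd : 0 < d) : MeasurableSet (cube n c d) :=
  (compact_cube n c hd).isClosed.measurableSet

/-- transferred function -/
noncomputable def trb {n : ℕ} (b : Rn n → ℝ) : (Fin n → ℝ) → ℝ := fun y => b ((eRn n).symm y)

lemma trb_locInt {n : ℕ} {b : Rn n → ℝ} (hb : LocallyIntegrable b volume) :
    LocallyIntegrable (trb b) volume := by
  rw [locallyIntegrable_iff]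
  intro K hK
  have hK' : IsCompact (eRn n ⁻¹' K) := by
    have : eRn n ⁻¹' K = (WithLp.toLp 2) '' K := by
      ext x
      constructor
      · intro hx; exact ⟨eRn n x, hx, rfl⟩
      · rintro ⟨y, hy, rfl⟩; exact hy
    rw [this]
    exact hK.image (PiLp.continuous_toLp 2 _)
  rw [← (eRn_mp n).integrableOn_comp_preimage (eRn n).measurableEmbedding]
  exact hb.integrableOn_isCompact hK'

lemma cubeAvg_eq {n : ℕ} (b : Rn n → ℝ) (c : Rn n) {d : ℝ} (hd : 0 < d) :
    cubeAvg n b c d = JNav (trb b) (eRn n c) (d / 2) := by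
  have h := (eRn_mp n).setIntegral_preimage_emb (eRn n).measurableEmbedding (trb b)
    (closedBall (eRn n c) (d / 2))
  have hv : volume.real (closedBall (eRn n c) (d / 2)) = d ^ n := by
    rw [Measure.real, JN_vol _ (by positivity), ENNReal.toReal_ofReal (by positivity)]
    congr 1; ring
  rw [cubeAvg, JNav, setAverage_eq, setAverage_eq, volr_cube n c hd, hv, ← h, ← cube_eq n c hd]
  rfl

lemma cube_lint {n : ℕ} (F : Rn n → ℝ≥0∞) (c : Rn n) {d : ℝ} (hd : 0 < d) :
    ∫⁻ x in cube n c d, F x =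
      ∫⁻ y in closedBall (eRn n c) (d / 2), F ((eRn n).symm y) := by
  rw [← (eRn_mp n).setLIntegral_comp_preimage_emb (eRn n).measurableEmbedding, cube_eq n c hd]
  simp

lemma osc_lint {n : ℕ} {b : Rn n → ℝ} (hb : LocallyIntegrable b volume) (c : Rn n) {d : ℝ}
    (hd : 0 < d) : ∫⁻ x in cube n c d, ‖b x - cubeAvg n b c d‖ₑ =
      ENNReal.ofReal (osc n b c d * d ^ n) := by
  have hi : IntegrableOn (fun x => b x - cubeAvg n b c d) (cube n c d) volume :=
    (hb.integrableOn_isCompact (compact_cube n c hd)).sub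
      (integrableOn_const (by rw [vol_cube n c hd]; exact ENNReal.ofReal_ne_top))
  rw [← ofReal_integral_norm_eq_lintegral_enorm hi, osc, setAverage_eq, volr_cube n c hd]
  congr 1
  have : d ^ n ≠ 0 := by positivity
  simp only [smul_eq_mul, Real.norm_eq_abs]
  field_simp

lemma trb_hyp {n : ℕ} {b : Rn n → ℝ} (hb : LocallyIntegrable b volume)
    (ho : ∀ c d, 0 < d → osc n b c d ≤ 1) : JNhyp (trb b) := by
  intro c R hR
  have h2R : 0 < 2 * R := by positivity
  have h1 := osc_lint hb ((eRn n).symm c) h2R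
  rw [cube_lint _ _ h2R, cubeAvg_eq _ _ h2R] at h1
  simp only [MeasurableEquiv.apply_symm_apply, mul_div_cancel_left₀ R (two_ne_zero' ℝ)] at h1
  change ∫⁻ y in closedBall c R, ‖trb b y - JNav (trb b) c R‖ₑ = _ at h1
  rw [h1, JN_vol c hR]
  apply ENNReal.ofReal_le_ofReal
  have := ho ((eRn n).symm c) (2 * R) h2R
  have hp : 0 < (2 * R) ^ n := by positivity
  nlinarith

lemma cube_cmp {n : ℕ} {b : Rn n → ℝ} (hb : LocallyIntegrable b volume)
    (ho : ∀ c d, 0 < d → osc n b c d ≤ 1) (c : Rn n) {d : ℝ} (hd : 0 < d) :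
    |cubeAvg n b c d - cubeAvg n b c (2 * d)| ≤ 2 ^ n := by
  have h2d : 0 < 2 * d := by positivity
  rw [cubeAvg_eq b c hd, cubeAvg_eq b c h2d]
  exact JN_av_cmp (trb_locInt hb) (trb_hyp hb ho) (by positivity) (by positivity)
    (closedBall_subset_closedBall (by linarith)) (by linarith)

lemma cube_cmp_pow {n : ℕ} {b : Rn n → ℝ} (hb : LocallyIntegrable b volume)
    (ho : ∀ c d, 0 < d → osc n b c d ≤ 1) (c : Rn n) {d : ℝ} (hd : 0 < d) (m : ℕ) :
    |cubeAvg n b c d - cubeAvg n b c (2 ^ m * d)| ≤ m * 2 ^ n := by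
  induction m with
  | zero => simp
  | succ m ih =>
    have h1 := cube_cmp hb ho c (d := 2 ^ m * d) (by positivity)
    rw [← mul_assoc, ← pow_succ'] at h1
    have := abs_sub_le (cubeAvg n b c d) (cubeAvg n b c (2 ^ m * d))
      (cubeAvg n b c (2 ^ (m + 1) * d))
    push_cast
    linarith

lemma cube_Lq (n : ℕ) (q : ℝ) (hq : 0 < q) : ∃ C : ℝ, 0 < C ∧
    ∀ b : Rn n → ℝ, LocallyIntegrable b volume → (∀ c d, 0 < d → osc n b c d ≤ 1) →
      ∀ (c : Rn n) (d : ℝ), 0 < d →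
        ∫⁻ x in cube n c d, ENNReal.ofReal (|b x - cubeAvg n b c d| ^ q) ≤
          ENNReal.ofReal (C * d ^ n) := by
  obtain ⟨C, hC, h⟩ := JN_Lq n q hq
  refine ⟨C, hC, fun b hb ho c d hd => ?_⟩
  have := h (trb b) (trb_locInt hb) (trb_hyp hb ho) (eRn n c) (d / 2) (by positivity)
  rw [cube_lint _ _ hd, cubeAvg_eq b c hd]
  refine this.trans (le_of_eq ?_)
  rw [JN_vol _ (by positivity), ← ENNReal.ofReal_mul hC.le]
  congr 3; ring

lemma rpow_add_le {a b q : ℝ} (ha : 0 ≤ a) (hb : 0 ≤ b) (hq : 0 ≤ q) :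
    (a + b) ^ q ≤ 2 ^ q * (a ^ q + b ^ q) := by
  have h1 : (a + b) ^ q ≤ (2 * max a b) ^ q := by
    apply Real.rpow_le_rpow (by positivity) _ hq
    linarith [le_max_left a b, le_max_right a b]
  have h2 : (max a b) ^ q ≤ a ^ q + b ^ q := by
    rcases max_cases a b with h | h <;> rw [h.1]
    · linarith [Real.rpow_nonneg hb q]
    · linarith [Real.rpow_nonneg ha q]
  rw [Real.mul_rpow (by norm_num) (le_max_of_le_left ha)] at h1
  have : (0:ℝ) < 2 ^ q := by positivity
  nlinarith

/-- the cube of side `2^m d` -/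
lemma big_cube (n : ℕ) (q : ℝ) (hq : 0 < q) : ∃ A : ℝ, 0 < A ∧
    ∀ b : Rn n → ℝ, LocallyIntegrable b volume → (∀ c d, 0 < d → osc n b c d ≤ 1) →
      ∀ (c : Rn n) (d : ℝ), 0 < d → ∀ k : ℕ,
        ∫⁻ x in cube n c (2 ^ (k + 2) * d),
            ENNReal.ofReal ((1 + |b x - cubeAvg n b c d|) ^ q) ≤
          ENNReal.ofReal (((k + 1) * A) ^ q * (2 ^ k * d) ^ n) := by
  obtain ⟨C, hC, h⟩ := cube_Lq n q hq
  refine ⟨(2 ^ q * (C + (1 + 2 * 2 ^ n) ^ q) * 4 ^ n) ^ (1 / q), by positivity,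
    fun b hb ho c d hd k => ?_⟩
  have hD : 0 < 2 ^ (k + 2) * d := by positivity
  set β := cubeAvg n b c d
  set D := 2 ^ (k + 2) * d with hDdef
  set β' := cubeAvg n b c D
  have hββ : |β - β'| ≤ ((k + 2 : ℕ) : ℝ) * 2 ^ n := cube_cmp_pow hb ho c hd (k + 2)
  set M : ℝ := (k + 1) * (1 + 2 * 2 ^ n) with hM
  have hMp : 0 < M := by positivity
  have hpt : ∀ x, ENNReal.ofReal ((1 + |b x - β|) ^ q) ≤
      ENNReal.ofReal (2 ^ q) * ENNReal.ofReal (|b x - β'| ^ q) +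
        ENNReal.ofReal (2 ^ q * M ^ q) := by
    intro x
    rw [← ENNReal.ofReal_mul (by positivity), ← ENNReal.ofReal_add (by positivity) (by positivity),
      ← mul_add]
    apply ENNReal.ofReal_le_ofReal
    refine le_trans ?_ (rpow_add_le (abs_nonneg _) hMp.le hq.le)
    apply Real.rpow_le_rpow (by positivity) _ hq.le
    have := abs_sub_le (b x) β' β
    rw [abs_sub_comm β' β] at this
    push_cast at hββ
    have h2 : (0:ℝ) < 2 ^ n := by positivity
    have hk : (0:ℝ) ≤ k := Nat.cast_nonneg k
    have : 0 ≤ (k:ℝ) * 2 ^ n := by positivity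
    rw [hM]
    nlinarith
  calc _ ≤ ∫⁻ x in cube n c D, (ENNReal.ofReal (2 ^ q) * ENNReal.ofReal (|b x - β'| ^ q) +
        ENNReal.ofReal (2 ^ q * M ^ q)) := lintegral_mono hpt
    _ = ENNReal.ofReal (2 ^ q) * (∫⁻ x in cube n c D, ENNReal.ofReal (|b x - β'| ^ q)) +
        ENNReal.ofReal (2 ^ q * M ^ q) * ENNReal.ofReal (D ^ n) := by
        rw [lintegral_add_right _ measurable_const, setLIntegral_const, vol_cube n c hD,
          lintegral_const_mul' _ _ ENNReal.ofReal_ne_top]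
    _ ≤ ENNReal.ofReal (2 ^ q) * ENNReal.ofReal (C * D ^ n) +
        ENNReal.ofReal (2 ^ q * M ^ q) * ENNReal.ofReal (D ^ n) := by
        gcongr
        exact h b hb ho c D hD
    _ ≤ _ := by
        rw [← ENNReal.ofReal_mul (by positivity), ← ENNReal.ofReal_mul (by positivity),
          ← ENNReal.ofReal_add (by positivity) (by positivity)]
        apply ENNReal.ofReal_le_ofReal
        rw [hM, Real.mul_rpow (by positivity) (by positivity),
          Real.mul_rpow (x := (k:ℝ) + 1) (y := (2 ^ q * (C + (1 + 2 * 2 ^ n) ^ q) * 4 ^ n) ^ (1 / q))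
            (by positivity) (by positivity), ← Real.rpow_mul (by positivity),
          one_div_mul_cancel hq.ne', Real.rpow_one,
          show D = 4 * (2 ^ k * d) by rw [hDdef, pow_add]; ring, mul_pow 4]
        have hk1 : (1:ℝ) ≤ ((k:ℝ) + 1) ^ q :=
          Real.one_le_rpow (by linarith [(Nat.cast_nonneg k : (0:ℝ) ≤ k)]) hq.le
        set P := (4:ℝ) ^ n * (2 ^ k * d) ^ n * 2 ^ q with hP
        have hPp : 0 < P := by positivity
        have e : C * P ≤ ((k:ℝ) + 1) ^ q * (C * P) := le_mul_of_one_le_left (by positivity) hk1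
        rw [hP] at e
        nlinarith

lemma norm_coord_le {n : ℕ} (x : Rn n) (i : Fin n) : |x i| ≤ ‖x‖ := by
  simpa using PiLp.norm_apply_le x i

lemma J_lemma (n : ℕ) (q δ : ℝ) (hq : 0 < q) (hδ : 0 < δ) : ∃ C : ℝ, 0 < C ∧
    ∀ b : Rn n → ℝ, LocallyIntegrable b volume → (∀ c d, 0 < d → osc n b c d ≤ 1) →
      ∀ (c : Rn n) (d : ℝ), 0 < d →
        ∫⁻ x in {x : Rn n | d < ‖x - c‖},
            ENNReal.ofReal ((1 + |b x - cubeAvg n b c d|) ^ q * ‖x - c‖ ^ (-(n + δ))) ≤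
          ENNReal.ofReal (C * d ^ (-δ)) := by
  obtain ⟨A, hA, h⟩ := big_cube n q hq
  have hfin := geom_sum_finite A ((2:ℝ) ^ (-δ)) q hA (by positivity)
    (Real.rpow_lt_one_of_one_lt_of_neg (by norm_num) (by linarith))
  set T := ∑' k : ℕ, ENNReal.ofReal (((k + 1) * A) ^ q * ((2:ℝ) ^ (-δ)) ^ k) with hT
  refine ⟨T.toReal + 1, by positivity, fun b hb ho c d hd => ?_⟩
  have hTle : T ≤ ENNReal.ofReal (T.toReal + 1) := by
    conv_lhs => rw [← ENNReal.ofReal_toReal hfin.ne]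
    exact ENNReal.ofReal_le_ofReal (by linarith)
  set S : ℕ → Set (Rn n) := fun k => {x | 2 ^ k * d < ‖x - c‖ ∧ ‖x - c‖ ≤ 2 ^ (k + 1) * d} with hS
  have hcov : {x : Rn n | d < ‖x - c‖} ⊆ ⋃ k, S k := by
    intro x hx
    have hx' : d < ‖x - c‖ := hx
    classical
    have hex : ∃ k : ℕ, ‖x - c‖ ≤ 2 ^ k * d := by
      obtain ⟨k, hk⟩ := pow_unbounded_of_one_lt (‖x - c‖ / d) (by norm_num : (1:ℝ) < 2)
      exact ⟨k, by rw [div_lt_iff₀ hd] at hk; exact hk.le⟩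
    have h1 := Nat.find_spec hex
    have hmin := fun m => Nat.find_min hex (m := m)
    set j := Nat.find hex
    have hj0 : j ≠ 0 := by
      intro h0
      rw [h0] at h1
      simp only [pow_zero, one_mul] at h1
      linarith
    obtain ⟨m, hm⟩ := Nat.exists_eq_succ_of_ne_zero hj0
    refine mem_iUnion.2 ⟨m, ?_, ?_⟩
    · have := hmin m (by omega)
      push Not at this
      exact this
    · rw [hm] at h1; exact h1
  set β := cubeAvg n b c d
  have hstep : ∀ k, ∫⁻ x in S k,
      ENNReal.ofReal ((1 + |b x - β|) ^ q * ‖x - c‖ ^ (-(n + δ))) ≤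
      ENNReal.ofReal (d ^ (-δ)) * ENNReal.ofReal (((k + 1) * A) ^ q * ((2:ℝ) ^ (-δ)) ^ k) := by
    intro k
    have hkd : 0 < 2 ^ k * d := by positivity
    have hSm : MeasurableSet (S k) := by
      have : Measurable fun x : Rn n => ‖x - c‖ := (measurable_id.sub_const c).norm
      exact (measurableSet_lt measurable_const this).inter (measurableSet_le this measurable_const)
    calc _ ≤ ∫⁻ x in S k, ENNReal.ofReal ((2 ^ k * d) ^ (-((n:ℝ) + δ))) *
          ENNReal.ofReal ((1 + |b x - β|) ^ q) := by
          refine setLIntegral_mono' hSm fun x hx => ?_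
          rw [← ENNReal.ofReal_mul (by positivity), mul_comm]
          apply ENNReal.ofReal_le_ofReal
          gcongr ?_ * _
          exact Real.rpow_le_rpow_of_nonpos hkd hx.1.le (by linarith [(Nat.cast_nonneg n : (0:ℝ) ≤ n)])
      _ = ENNReal.ofReal ((2 ^ k * d) ^ (-((n:ℝ) + δ))) *
          ∫⁻ x in S k, ENNReal.ofReal ((1 + |b x - β|) ^ q) :=
          lintegral_const_mul' _ _ ENNReal.ofReal_ne_top
      _ ≤ ENNReal.ofReal ((2 ^ k * d) ^ (-((n:ℝ) + δ))) *
          ENNReal.ofReal (((k + 1) * A) ^ q * (2 ^ k * d) ^ n) := by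
          gcongr
          refine le_trans (lintegral_mono_set ?_) (h b hb ho c d hd k)
          intro x hx i
          have h1 := norm_coord_le (x - c) i
          have h2 := hx.2
          have : (x - c) i = x i - c i := rfl
          rw [this] at h1
          refine (h1.trans h2).trans (le_of_eq ?_)
          rw [pow_succ 2 (k + 1)]; ring
      _ = _ := by
          rw [← ENNReal.ofReal_mul (by positivity), ← ENNReal.ofReal_mul (by positivity)]
          congr 1
          rw [neg_add, Real.rpow_add hkd, Real.rpow_neg hkd.le, Real.rpow_natCast,
            Real.mul_rpow (by positivity) hd.le, ← Real.rpow_natCast 2 k,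
            ← Real.rpow_natCast _ k, ← Real.rpow_mul (by norm_num), ← Real.rpow_mul (by norm_num),
            mul_comm (k:ℝ) (-δ)]
          field_simp
  calc _ ≤ ∫⁻ x in ⋃ k, S k, _ := lintegral_mono_set hcov
    _ ≤ ∑' k, ∫⁻ x in S k, _ := lintegral_iUnion_le _ _
    _ ≤ ∑' k : ℕ, ENNReal.ofReal (d ^ (-δ)) *
        ENNReal.ofReal (((k + 1) * A) ^ q * ((2:ℝ) ^ (-δ)) ^ k) := ENNReal.tsum_le_tsum hstep
    _ = ENNReal.ofReal (d ^ (-δ)) * T := ENNReal.tsum_mul_left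
    _ ≤ _ := by
        rw [mul_comm, ENNReal.ofReal_mul (by positivity)]
        gcongr

end Transfer

section Pointwise

lemma meas_sign : Measurable Real.sign := by
  unfold Real.sign
  exact Measurable.ite measurableSet_Iio measurable_const
    (Measurable.ite measurableSet_Ioi measurable_const measurable_const)

lemma abs_sign_le (x : ℝ) : |Real.sign x| ≤ 1 := by
  rcases Real.sign_apply_eq x with h | h | h <;> rw [h] <;> norm_num

lemma mul_sign_eq (x : ℝ) : x * Real.sign x = |x| := by
  rcases lt_trichotomy x 0 with h | h | h
  · rw [Real.sign_of_neg h, abs_of_neg h]; ring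
  · rw [h]; simp
  · rw [Real.sign_of_pos h, abs_of_pos h]; ring

lemma abstract_comm {X : Type*} [MeasurableSpace X] {μ : Measure X} {Q : Set X}
    (hQ : MeasurableSet Q) {v : ℝ} (hv : 0 < v) (hμ : μ Q = ENNReal.ofReal v)
    {b k : X → ℝ} (hb : IntegrableOn b Q μ) (hk : AEStronglyMeasurable k (μ.restrict Q))
    {m M D k0 w : ℝ} (hw : 0 < w) (hm : 0 ≤ m) (hmk : ∀ y ∈ Q, m ≤ k y)
    (hkM : ∀ y ∈ Q, k y ≤ M) (hD : ∀ y ∈ Q, |k y - k0| ≤ D) (bx : ℝ)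
    {β o c0 : ℝ} (hβ : β = ⨍ y in Q, b y ∂μ) (ho : o = ⨍ y in Q, |b y - β| ∂μ)
    (hc0 : c0 = ⨍ y in Q, Real.sign (b y - β) ∂μ) :
    ∃ F H : ℝ, (∫ y in Q, b y * (w * (Real.sign (b y - β) - c0)) * k y ∂μ)
        - bx * (∫ y in Q, (w * (Real.sign (b y - β) - c0)) * k y ∂μ) = F - (bx - β) * H ∧
      m * (w * v * o) ≤ F ∧ F ≤ M * (w * v * o) ∧ |H| ≤ D * (2 * w * v) := by
  have hfin : μ Q ≠ ⊤ := by rw [hμ]; exact ENNReal.ofReal_ne_top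
  have hreal : μ.real Q = v := by rw [Measure.real, hμ, ENNReal.toReal_ofReal hv.le]
  have : IsFiniteMeasure (μ.restrict Q) := ⟨by simpa using hfin.lt_top⟩
  have hbβ : Integrable (fun y => b y - β) (μ.restrict Q) := hb.sub (integrable_const β)
  have hsm : AEStronglyMeasurable (fun y => Real.sign (b y - β)) (μ.restrict Q) :=
    (meas_sign.comp_aemeasurable hbβ.aestronglyMeasurable.aemeasurable).aestronglyMeasurable
  have hs : Integrable (fun y => Real.sign (b y - β)) (μ.restrict Q) :=
    Integrable.of_bound hsm 1 (Eventually.of_forall fun y => abs_sign_le _)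
  have hsint : ∫ y in Q, Real.sign (b y - β) ∂μ = c0 * v := by
    rw [hc0, setAverage_eq, hreal, smul_eq_mul]; field_simp
  have hbint : ∫ y in Q, b y ∂μ = β * v := by
    rw [hβ, setAverage_eq, hreal, smul_eq_mul]; field_simp
  have hoint : ∫ y in Q, |b y - β| ∂μ = o * v := by
    rw [ho, setAverage_eq, hreal, smul_eq_mul]; field_simp
  have hc0le : |c0| ≤ 1 := by
    have h1 := norm_setIntegral_le_of_norm_le_const (f := fun y => Real.sign (b y - β))
      (C := 1) hfin.lt_top (fun y _ => abs_sign_le _)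
    rw [hsint, hreal, Real.norm_eq_abs, abs_mul, abs_of_pos hv] at h1
    exact le_of_mul_le_mul_right h1 hv
  set φ : X → ℝ := fun y => w * (Real.sign (b y - β) - c0) with hφ
  have hφm : AEStronglyMeasurable φ (μ.restrict Q) :=
    (hsm.sub aestronglyMeasurable_const).const_mul w
  have hφb : ∀ y, ‖φ y‖ ≤ 2 * w := by
    intro y
    rw [hφ, Real.norm_eq_abs, abs_mul, abs_of_pos hw]
    have := abs_sub (Real.sign (b y - β)) c0
    have := abs_sign_le (b y - β)
    nlinarith
  have hφi : Integrable φ (μ.restrict Q) :=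
    Integrable.of_bound hφm (2 * w) (Eventually.of_forall hφb)
  have hφ0 : ∫ y in Q, φ y ∂μ = 0 := by
    rw [hφ, integral_const_mul, integral_sub hs (integrable_const c0), hsint, setIntegral_const,
      hreal, smul_eq_mul]
    ring
  have hkb : ∀ᵐ y ∂(μ.restrict Q), ‖k y‖ ≤ M := by
    filter_upwards [ae_restrict_mem hQ] with y hy
    rw [Real.norm_eq_abs, abs_of_nonneg (hm.trans (hmk y hy))]
    exact hkM y hy
  have hφk : Integrable (fun y => φ y * k y) (μ.restrict Q) := hφi.mul_bdd hk hkb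
  have hbφ : Integrable (fun y => b y * φ y) (μ.restrict Q) :=
    hb.mul_bdd hφm (Eventually.of_forall hφb)
  have hbφk : Integrable (fun y => b y * φ y * k y) (μ.restrict Q) := hbφ.mul_bdd hk hkb
  have hBφ : Integrable (fun y => (b y - β) * φ y) (μ.restrict Q) :=
    hbβ.mul_bdd hφm (Eventually.of_forall hφb)
  have hBφk : Integrable (fun y => (b y - β) * φ y * k y) (μ.restrict Q) := hBφ.mul_bdd hk hkb
  have hpos : ∀ y, 0 ≤ (b y - β) * φ y := by
    intro y
    have e : (b y - β) * φ y = w * (|b y - β| - c0 * (b y - β)) := by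
      rw [hφ, ← mul_sign_eq]; ring
    rw [e]
    have : c0 * (b y - β) ≤ |b y - β| := by
      refine (le_abs_self _).trans ?_
      rw [abs_mul]
      exact mul_le_of_le_one_left (abs_nonneg _) hc0le
    exact mul_nonneg hw.le (by linarith)
  have hBφint : ∫ y in Q, (b y - β) * φ y ∂μ = w * v * o := by
    have e : ∀ y, (b y - β) * φ y = w * (|b y - β| - c0 * (b y - β)) := by
      intro y
      rw [hφ, ← mul_sign_eq]; ring
    simp_rw [e]
    rw [integral_const_mul, integral_sub hbβ.abs (hbβ.const_mul c0), integral_const_mul,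
      integral_sub hb (integrable_const β), hbint, hoint, setIntegral_const, hreal, smul_eq_mul]
    ring
  refine ⟨∫ y in Q, (b y - β) * φ y * k y ∂μ, ∫ y in Q, φ y * k y ∂μ, ?_, ?_, ?_, ?_⟩
  · have : ∫ y in Q, (b y - β) * φ y * k y ∂μ =
        (∫ y in Q, b y * φ y * k y ∂μ) - β * ∫ y in Q, φ y * k y ∂μ := by
      rw [← integral_const_mul, ← integral_sub hbφk (hφk.const_mul β)]
      congr 1; ext y; ring
    rw [this]; ring
  · rw [← hBφint, ← integral_const_mul]
    refine setIntegral_mono_on (hBφ.const_mul m) hBφk hQ fun y hy => ?_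
    rw [mul_comm]
    exact mul_le_mul_of_nonneg_left (hmk y hy) (hpos y)
  · rw [← hBφint, ← integral_const_mul]
    refine setIntegral_mono_on hBφk (hBφ.const_mul M) hQ fun y hy => ?_
    rw [mul_comm M]
    exact mul_le_mul_of_nonneg_left (hkM y hy) (hpos y)
  · have e : ∫ y in Q, φ y * k y ∂μ = ∫ y in Q, φ y * (k y - k0) ∂μ := by
      simp_rw [mul_sub]
      rw [integral_sub hφk (hφi.mul_const k0), integral_mul_const, hφ0]; ring
    rw [e]
    have h1 := norm_setIntegral_le_of_norm_le_const (f := fun y => φ y * (k y - k0))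
      (C := 2 * w * D) hfin.lt_top (fun y hy => by
        rw [norm_mul]
        exact mul_le_mul (hφb y) (hD y hy) (norm_nonneg _) (by positivity))
    rw [hreal, Real.norm_eq_abs] at h1
    linarith

lemma rpow_neg_lip {κ m u v : ℝ} (hκ : 0 < κ) (hm : 0 < m) (hu : m ≤ u) (hv : m ≤ v) :
    |u ^ (-κ) - v ^ (-κ)| ≤ κ * m ^ (-κ - 1) * |u - v| := by
  have h := (convex_Ici m).norm_image_sub_le_of_norm_hasDerivWithin_le
    (f := fun t : ℝ => t ^ (-κ)) (f' := fun t => (-κ) * t ^ (-κ - 1))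
    (C := κ * m ^ (-κ - 1)) (x := v) (y := u)
    (fun t ht => (Real.hasDerivAt_rpow_const
      (Or.inl (lt_of_lt_of_le hm ht).ne')).hasDerivWithinAt)
    (fun t ht => by
      have htm : m ≤ t := ht
      have ht0 : 0 < t := lt_of_lt_of_le hm htm
      rw [norm_mul, Real.norm_eq_abs, Real.norm_eq_abs, abs_neg, abs_of_pos hκ,
        abs_of_pos (by positivity)]
      have := Real.rpow_le_rpow_of_nonpos hm htm (by linarith : -κ - 1 ≤ 0)
      gcongr) hv hu
  simpa using h

lemma norm_cube_le {n : ℕ} {c y : Rn n} {d : ℝ} (hd : 0 < d) (hy : y ∈ cube n c d) :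
    ‖y - c‖ ≤ n * d / 2 := by
  apply abs_le_of_sq_le_sq' _ (by positivity) |>.2
  rw [EuclideanSpace.norm_sq_eq]
  calc ∑ i, ‖(y - c) i‖ ^ 2 ≤ ∑ i : Fin n, (d / 2) ^ 2 := by
        refine Finset.sum_le_sum fun i _ => ?_
        exact pow_le_pow_left₀ (norm_nonneg _) (hy i) 2
    _ = n * (d / 2) ^ 2 := by simp
    _ ≤ _ := by
        have : (n : ℝ) ≤ (n : ℝ) ^ 2 := by
          exact_mod_cast Nat.le_self_pow two_ne_zero n
        have h2 : 0 ≤ (d / 2) ^ 2 := by positivity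
        nlinarith

lemma dist_bounds {n : ℕ} {c x y : Rn n} {d : ℝ} (hd : 0 < d) (hn : 0 < n)
    (hx : 2 * n * d ≤ ‖x - c‖) (hy : ‖y - c‖ ≤ n * d / 2) :
    ‖x - c‖ / 2 ≤ ‖x - y‖ ∧ ‖x - y‖ ≤ 2 * ‖x - c‖ := by
  have e1 : x - c = (x - y) + (y - c) := by abel
  have e2 : x - y = (x - c) - (y - c) := by abel
  have h1 : ‖x - c‖ ≤ ‖x - y‖ + ‖y - c‖ := by rw [e1]; exact norm_add_le _ _
  have h2 : ‖x - y‖ ≤ ‖x - c‖ + ‖y - c‖ := by rw [e2]; exact norm_sub_le _ _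
  have : (0:ℝ) < n * d := by positivity
  constructor <;> linarith

lemma base_bounds {n : ℕ} {c x y z : Rn n} {d : ℝ} (hd : 0 < d) (hn : 0 < n)
    (hx : 2 * n * d ≤ ‖x - c‖) (hy : ‖y - c‖ ≤ n * d / 2) (hz : ‖z - c‖ ≤ n * d / 2) :
    ‖x - c‖ ^ 2 / 2 ≤ ‖x - y‖ ^ 2 + ‖x - z‖ ^ 2 ∧
      ‖x - y‖ ^ 2 + ‖x - z‖ ^ 2 ≤ 8 * ‖x - c‖ ^ 2 := by
  obtain ⟨a1, a2⟩ := dist_bounds hd hn hx hy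
  obtain ⟨b1, b2⟩ := dist_bounds hd hn hx hz
  have := norm_nonneg (x - c)
  constructor <;> nlinarith [norm_nonneg (x - y), norm_nonneg (x - z)]

lemma meas_fracKernel (n : ℕ) (α : ℝ) (x : Rn n) :
    Measurable fun p : Rn n × Rn n => fracKernel n α x p.1 p.2 := by
  unfold fracKernel
  have h1 : Measurable fun p : Rn n × Rn n => ‖x - p.1‖ ^ 2 + ‖x - p.2‖ ^ 2 := by fun_prop
  exact h1.pow_const _

lemma comm_struct (n : ℕ) (hn : 0 < n) (α p₁ p₂ κ : ℝ) (hκ : κ = n - α / 2) (hκ0 : 0 < κ) :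
    ∃ c₁ c₂ c₃ : ℝ, 0 < c₁ ∧ 0 < c₂ ∧ 0 < c₃ ∧ ∀ b : Rn n → ℝ, LocallyIntegrable b volume →
      ∀ (c : Rn n) (d : ℝ), 0 < d → ∀ x : Rn n, 2 * n * d ≤ ‖x - c‖ →
        ∃ F H : ℝ, commI n α b (testF n p₁ b c d) (testG n p₂ c d) x =
            F - (b x - cubeAvg n b c d) * H ∧
          c₁ * ‖x - c‖ ^ (-(2 * κ)) *
            (((d ^ n) ^ (-(1 / p₁)) * d ^ n) * ((d ^ n) ^ (-(1 / p₂)) * d ^ n) * osc n b c d) ≤ F ∧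
          F ≤ c₂ * ‖x - c‖ ^ (-(2 * κ)) *
            (((d ^ n) ^ (-(1 / p₁)) * d ^ n) * ((d ^ n) ^ (-(1 / p₂)) * d ^ n) * osc n b c d) ∧
          |H| ≤ c₃ * d * ‖x - c‖ ^ (-(2 * κ) - 1) *
            (((d ^ n) ^ (-(1 / p₁)) * d ^ n) * ((d ^ n) ^ (-(1 / p₂)) * d ^ n)) := by
  refine ⟨8 ^ (-κ), (1 / 2) ^ (-κ), κ * (1 / 2) ^ (-κ - 1) * (n / 2 * 3) * 2, by positivity,
    by positivity, by positivity, fun b hb c d hd x hx => ?_⟩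
  set r := ‖x - c‖ with hr
  have hnd : (0:ℝ) < n * d := by positivity
  have hr0 : 0 < r := by linarith
  set w₁ := (d ^ n) ^ (-(1 / p₁)) with hw₁
  set w₂ := (d ^ n) ^ (-(1 / p₂)) with hw₂
  have hw₁0 : 0 < w₁ := by positivity
  have hw₂0 : 0 < w₂ := by positivity
  set Q := cube n c d with hQdef
  have hQ : MeasurableSet Q := meas_cube n c hd
  have hvol : volume Q = ENNReal.ofReal (d ^ n) := vol_cube n c hd
  have hvolr : volume.real Q = d ^ n := volr_cube n c hd
  have hfin : volume Q ≠ ⊤ := by rw [hvol]; exact ENNReal.ofReal_ne_top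
  have : IsFiniteMeasure (volume.restrict Q) := ⟨by simpa using hfin.lt_top⟩
  have hdn : 0 < d ^ n := by positivity
  have hcc : ‖c - c‖ ≤ n * d / 2 := by simp; positivity
  -- kernel bounds
  have hKlo : ∀ y z : Rn n, ‖y - c‖ ≤ n * d / 2 → ‖z - c‖ ≤ n * d / 2 →
      (8 * r ^ 2) ^ (-κ) ≤ fracKernel n α x y z := by
    intro y z hy hz
    obtain ⟨h1, h2⟩ := base_bounds hd hn hx hy hz
    rw [fracKernel, ← hκ]
    exact Real.rpow_le_rpow_of_nonpos (lt_of_lt_of_le (by positivity) h1) h2 (by linarith)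
  have hKhi : ∀ y z : Rn n, ‖y - c‖ ≤ n * d / 2 → ‖z - c‖ ≤ n * d / 2 →
      fracKernel n α x y z ≤ (r ^ 2 / 2) ^ (-κ) := by
    intro y z hy hz
    obtain ⟨h1, h2⟩ := base_bounds hd hn hx hy hz
    rw [fracKernel, ← hκ]
    exact Real.rpow_le_rpow_of_nonpos (by positivity) h1 (by linarith)
  have hKd : ∀ y z : Rn n, ‖y - c‖ ≤ n * d / 2 → ‖z - c‖ ≤ n * d / 2 →
      |fracKernel n α x y z - fracKernel n α x c z| ≤
        κ * (r ^ 2 / 2) ^ (-κ - 1) * (n * d / 2 * (3 * r)) := by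
    intro y z hy hz
    obtain ⟨h1, h2⟩ := base_bounds hd hn hx hy hz
    obtain ⟨h3, h4⟩ := base_bounds hd hn hx hcc hz
    rw [fracKernel, fracKernel, ← hκ]
    refine (rpow_neg_lip hκ0 (by positivity) h1 h3).trans ?_
    gcongr
    obtain ⟨a1, a2⟩ := dist_bounds hd hn hx hy
    have e : ‖x - y‖ ^ 2 + ‖x - z‖ ^ 2 - (‖x - c‖ ^ 2 + ‖x - z‖ ^ 2) =
        (‖x - y‖ - ‖x - c‖) * (‖x - y‖ + ‖x - c‖) := by ring
    rw [e, abs_mul]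
    have h5 : |‖x - y‖ - ‖x - c‖| ≤ n * d / 2 := by
      refine (abs_norm_sub_norm_le _ _).trans ?_
      rw [show x - y - (x - c) = -(y - c) by abel, norm_neg]
      exact hy
    have h6 : |‖x - y‖ + ‖x - c‖| ≤ 3 * r := by
      rw [abs_of_nonneg (by positivity)]; linarith
    exact mul_le_mul h5 h6 (abs_nonneg _) (by positivity)
  have hKint : ∀ y : Rn n, ‖y - c‖ ≤ n * d / 2 →
      IntegrableOn (fun z => fracKernel n α x y z) Q volume := by
    intro y hy
    refine Integrable.of_bound ((meas_fracKernel n α x).comp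
      (measurable_const.prodMk measurable_id)).aestronglyMeasurable ((r ^ 2 / 2) ^ (-κ)) ?_
    filter_upwards [ae_restrict_mem hQ] with z hz
    have h1 := hKlo y z hy (norm_cube_le hd hz)
    have h0 : 0 ≤ fracKernel n α x y z := le_trans (by positivity) h1
    rw [Real.norm_eq_abs, abs_of_nonneg h0]
    exact hKhi y z hy (norm_cube_le hd hz)
  -- the function k
  set k : Rn n → ℝ := fun y => ∫ z in Q, fracKernel n α x y z * w₂ with hk
  have hkeq : ∀ y, k y = (∫ z in Q, fracKernel n α x y z) * w₂ := fun y => integral_mul_const _ _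
  have hkm : StronglyMeasurable k := by
    have : StronglyMeasurable fun p : Rn n × Rn n => fracKernel n α x p.1 p.2 * w₂ :=
      ((meas_fracKernel n α x).mul_const w₂).stronglyMeasurable
    exact this.integral_prod_right' (ν := volume.restrict Q)
  have hklo : ∀ y ∈ Q, (8 * r ^ 2) ^ (-κ) * (w₂ * d ^ n) ≤ k y := by
    intro y hy
    have hy' := norm_cube_le hd hy
    have h1 := setIntegral_mono_on (integrable_const ((8 * r ^ 2) ^ (-κ))) (hKint y hy') hQ
      fun z hz => hKlo y z hy' (norm_cube_le hd hz)
    rw [setIntegral_const, hvolr, smul_eq_mul] at h1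
    rw [hkeq]
    nlinarith
  have hkhi : ∀ y ∈ Q, k y ≤ (r ^ 2 / 2) ^ (-κ) * (w₂ * d ^ n) := by
    intro y hy
    have hy' := norm_cube_le hd hy
    have h1 := setIntegral_mono_on (hKint y hy') (integrable_const ((r ^ 2 / 2) ^ (-κ))) hQ
      fun z hz => hKhi y z hy' (norm_cube_le hd hz)
    rw [setIntegral_const, hvolr, smul_eq_mul] at h1
    rw [hkeq]
    nlinarith
  have hkd : ∀ y ∈ Q, |k y - k c| ≤
      κ * (r ^ 2 / 2) ^ (-κ - 1) * (n * d / 2 * (3 * r)) * (w₂ * d ^ n) := by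
    intro y hy
    have hy' := norm_cube_le hd hy
    rw [hkeq, hkeq, ← sub_mul, ← integral_sub (hKint y hy') (hKint c hcc), abs_mul,
      abs_of_pos hw₂0]
    have h1 := norm_setIntegral_le_of_norm_le_const (μ := volume) (s := Q)
      (f := fun z => fracKernel n α x y z - fracKernel n α x c z) hfin.lt_top
      (fun z hz => hKd y z hy' (norm_cube_le hd hz))
    rw [hvolr, Real.norm_eq_abs] at h1
    nlinarith
  -- rewrite the commutator
  set β := cubeAvg n b c d with hβ
  set c0 := ⨍ z in Q, Real.sign (b z - β) with hc0
  have hinner : ∀ (s : ℝ) (y : Rn n),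
      ∫ z, fracKernel n α x y z * (s * testG n p₂ c d z) = s * k y := by
    intro s y
    rw [hk, ← integral_const_mul, ← integral_indicator hQ]
    congr 1; ext z
    by_cases hz : z ∈ Q
    · rw [indicator_of_mem hz, testG, indicator_of_mem hz]; ring
    · rw [indicator_of_notMem hz, testG, indicator_of_notMem hz]; ring
  have hI1 : Iop n α (testF n p₁ b c d) (testG n p₂ c d) x =
      ∫ y in Q, (w₁ * (Real.sign (b y - β) - c0)) * k y := by
    rw [Iop, ← integral_indicator hQ]
    congr 1; ext y
    rw [hinner]
    by_cases hy : y ∈ Q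
    · rw [indicator_of_mem hy, testF, indicator_of_mem hy]
    · rw [indicator_of_notMem hy, testF, indicator_of_notMem hy]; ring
  have hI2 : Iop n α (fun y => b y * testF n p₁ b c d y) (testG n p₂ c d) x =
      ∫ y in Q, b y * (w₁ * (Real.sign (b y - β) - c0)) * k y := by
    rw [Iop, ← integral_indicator hQ]
    congr 1; ext y
    rw [hinner]
    by_cases hy : y ∈ Q
    · rw [indicator_of_mem hy, testF, indicator_of_mem hy]
    · rw [indicator_of_notMem hy, testF, indicator_of_notMem hy]; ring
  obtain ⟨F, H, h1, h2, h3, h4⟩ := abstract_comm hQ hdn hvol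
    (hb.integrableOn_isCompact (compact_cube n c hd)) hkm.aestronglyMeasurable hw₁0
    (by positivity) hklo hkhi hkd (b x) (β := β) (o := osc n b c d) (c0 := c0) rfl rfl rfl
  have er : (r ^ 2) ^ (-κ) = r ^ (-(2 * κ)) := by
    rw [← Real.rpow_natCast, ← Real.rpow_mul hr0.le]; congr 1; push_cast; ring
  have er2 : (r ^ 2) ^ (-κ - 1) * r = r ^ (-(2 * κ) - 1) := by
    rw [← Real.rpow_natCast, ← Real.rpow_mul hr0.le]
    nth_rewrite 2 [← Real.rpow_one r]
    rw [← Real.rpow_add hr0]; congr 1; push_cast; ring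
  have e8 : (8 * r ^ 2) ^ (-κ) = 8 ^ (-κ) * r ^ (-(2 * κ)) := by
    rw [Real.mul_rpow (by norm_num) (by positivity), er]
  have e2 : (r ^ 2 / 2) ^ (-κ) = (1 / 2) ^ (-κ) * r ^ (-(2 * κ)) := by
    rw [show r ^ 2 / 2 = 1 / 2 * r ^ 2 by ring, Real.mul_rpow (by norm_num) (by positivity), er]
  have e3 : (r ^ 2 / 2) ^ (-κ - 1) * r = (1 / 2) ^ (-κ - 1) * r ^ (-(2 * κ) - 1) := by
    rw [show r ^ 2 / 2 = 1 / 2 * r ^ 2 by ring, Real.mul_rpow (by norm_num) (by positivity),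
      ← er2]; ring
  refine ⟨F, H, ?_, ?_, ?_, ?_⟩
  · rw [← h1, commI, hI1, hI2]
  · refine le_trans (le_of_eq ?_) h2
    rw [e8]; ring
  · refine h3.trans (le_of_eq ?_)
    rw [e2]; ring
  · refine h4.trans (le_of_eq ?_)
    calc _ = κ * ((r ^ 2 / 2) ^ (-κ - 1) * r) * (n / 2 * d * 3) * (w₂ * d ^ n) * (2 * w₁ * d ^ n) := by
          ring
      _ = _ := by rw [e3]; ring

end Pointwise

section Final

open Metric

lemma osc_le_one {n : ℕ} {b : Rn n → ℝ} (hbmo : bmoNorm n b = 1) :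
    ∀ c d, 0 < d → osc n b c d ≤ 1 := by
  intro c d hd
  have hbdd : BddAbove (range fun cd : Rn n × {d : ℝ // 0 < d} => osc n b cd.1 cd.2.1) := by
    by_contra h
    have h0 : bmoNorm n b = 0 := Real.iSup_of_not_bddAbove h
    rw [hbmo] at h0
    exact one_ne_zero h0
  rw [← hbmo]
  exact le_ciSup hbdd (c, ⟨d, hd⟩)

lemma ann_vol {n : ℕ} (hn : 0 < n) (c : Rn n) {ρ : ℝ} (hρ : 0 < ρ) :
    ENNReal.ofReal (ρ ^ n) * volume (ball (0 : Rn n) 1) ≤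
      volume {x : Rn n | ρ < ‖x - c‖ ∧ ‖x - c‖ < 2 * ρ} := by
  have hsub : ball c (2 * ρ) ⊆ {x : Rn n | ρ < ‖x - c‖ ∧ ‖x - c‖ < 2 * ρ} ∪ closedBall c ρ := by
    intro x hx
    rw [mem_ball, dist_eq_norm] at hx
    rcases lt_or_ge ρ ‖x - c‖ with h | h
    · exact Or.inl ⟨h, hx⟩
    · right; rwa [mem_closedBall, dist_eq_norm]
  have h1 := (measure_mono hsub).trans (measure_union_le (μ := volume) _ _)
  rw [Measure.addHaar_ball_of_pos _ _ (by positivity), Measure.addHaar_closedBall _ _ hρ.le,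
    finrank_euclideanSpace, Fintype.card_fin] at h1
  have hω : volume (ball (0 : Rn n) 1) ≠ ⊤ := measure_ball_lt_top.ne
  have h2 : ENNReal.ofReal (ρ ^ n) * volume (ball (0 : Rn n) 1) +
      ENNReal.ofReal (ρ ^ n) * volume (ball (0 : Rn n) 1) ≤
      ENNReal.ofReal ((2 * ρ) ^ n) * volume (ball (0 : Rn n) 1) := by
    rw [← add_mul, ← ENNReal.ofReal_add (by positivity) (by positivity)]
    gcongr
    rw [mul_pow]
    have : (2:ℝ) ≤ 2 ^ n := le_self_pow₀ (by norm_num) hn.ne'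
    have : 0 < ρ ^ n := by positivity
    nlinarith
  exact ENNReal.le_of_add_le_add_right (ENNReal.mul_ne_top ENNReal.ofReal_ne_top hω) (h2.trans h1)

lemma W_eq {n : ℕ} (hn : 0 < n) {p₁ p₂ q α κ s d : ℝ} (hd : 0 < d) (hq0 : 0 < q)
    (hκ : κ = n - α / 2) (hs : s = 2 * κ * q - n)
    (hq : 1 / q = 1 / p₁ + 1 / p₂ - α / n) :
    ((d ^ n) ^ (-(1 / p₁)) * d ^ n) * ((d ^ n) ^ (-(1 / p₂)) * d ^ n) = d ^ (s / q) := by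
  have hn' : (n:ℝ) ≠ 0 := by positivity
  rw [← Real.rpow_natCast, ← Real.rpow_mul hd.le, ← Real.rpow_mul hd.le, ← Real.rpow_add hd,
    ← Real.rpow_add hd, ← Real.rpow_add hd]
  congr 1
  have e : s / q = 2 * κ - n * (1 / q) := by rw [hs]; field_simp
  rw [e, hq, hκ]
  field_simp
  ring

/-- integrand of the J lemma -/
noncomputable def Jint (n : ℕ) (q δ : ℝ) (b : Rn n → ℝ) (c : Rn n) (d : ℝ) (x : Rn n) : ℝ :=
  (1 + |b x - cubeAvg n b c d|) ^ q * ‖x - c‖ ^ (-(n + δ))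

lemma Jint_nonneg (n : ℕ) (q δ : ℝ) (b : Rn n → ℝ) (c : Rn n) (d : ℝ) (x : Rn n) :
    0 ≤ Jint n q δ b c d x := by unfold Jint; positivity

lemma Jint_aem {n : ℕ} (q δ : ℝ) {b : Rn n → ℝ} (hb : LocallyIntegrable b volume) (c : Rn n)
    (d : ℝ) : AEMeasurable (Jint n q δ b c d) volume := by
  unfold Jint
  have h1 : AEMeasurable (fun x => 1 + |b x - cubeAvg n b c d|) volume :=
    (continuous_abs.measurable.comp_aemeasurable
      (hb.aestronglyMeasurable.aemeasurable.sub_const _)).const_add 1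
  have h2 : Measurable fun x : Rn n => ‖x - c‖ := (measurable_id.sub_const c).norm
  exact (h1.pow_const q).mul (h2.pow_const _).aemeasurable

lemma rpow_split {r ρ e n' δ : ℝ} (hρ : 0 < ρ) (hr : ρ ≤ r) (he : δ ≤ e) :
    r ^ (-(n' + e)) ≤ ρ ^ (-(e - δ)) * r ^ (-(n' + δ)) := by
  have hr0 : 0 < r := lt_of_lt_of_le hρ hr
  have : r ^ (-(n' + e)) = r ^ (-(e - δ)) * r ^ (-(n' + δ)) := by
    rw [← Real.rpow_add hr0]; congr 1; ring
  rw [this]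
  gcongr ?_ * _
  exact Real.rpow_le_rpow_of_nonpos hρ hr (by linarith)

set_option maxHeartbeats 2000000 in
/-- pointwise consequences -/
lemma comm_pt (n : ℕ) (hn : 0 < n) (p₁ p₂ q α κ s : ℝ) (hq0 : 0 < q)
    (hκ : κ = n - α / 2) (hκ0 : 0 < κ) (hs : s = 2 * κ * q - n) (hs0 : 0 < s)
    (hq : 1 / q = 1 / p₁ + 1 / p₂ - α / n) :
    ∃ c₁ c₂ c₃ : ℝ, 0 < c₁ ∧ 0 < c₂ ∧ 0 < c₃ ∧ ∀ b : Rn n → ℝ, LocallyIntegrable b volume →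
      (∀ c d, 0 < d → osc n b c d ≤ 1) →
      ∀ (c : Rn n) (d γ : ℝ), 0 < d → 2 * n ≤ γ → ∀ x : Rn n, γ * d < ‖x - c‖ →
        (|commI n α b (testF n p₁ b c d) (testG n p₂ c d) x| ^ q ≤
          c₂ * (d ^ (s / 2) * γ ^ (-(s / 2))) * Jint n q (s / 2) b c d x) ∧
        (∀ ε, 0 < ε → ε ≤ osc n b c d → (c₁ * ε) ^ q * (d ^ s * ‖x - c‖ ^ (-(n + s))) ≤
          2 ^ q * |commI n α b (testF n p₁ b c d) (testG n p₂ c d) x| ^ q +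
            c₃ * (d ^ (q / 2) * γ ^ (-(s + q / 2))) * Jint n q (q / 2) b c d x) := by
  obtain ⟨c₁, c₂, c₃, h1, h2, h3, h⟩ := comm_struct n hn α p₁ p₂ κ hκ hκ0
  refine ⟨c₁, (c₂ + c₃) ^ q, 2 ^ q * c₃ ^ q, h1, by positivity, by positivity,
    fun b hb ho c d γ hd hγ x hx => ?_⟩
  have hn1 : (1:ℝ) ≤ n := by exact_mod_cast hn
  have hγ0 : 0 < γ := by linarith
  have hγd : 0 < γ * d := by positivity
  obtain ⟨F, H, e, hF1, hF2, hH⟩ := h b hb c d hd x (by nlinarith)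
  rw [W_eq hn hd hq0 hκ hs hq] at hF1 hF2 hH
  set r := ‖x - c‖ with hr
  have hr0 : 0 < r := hγd.trans hx
  set B := b x - cubeAvg n b c d with hB
  set T := commI n α b (testF n p₁ b c d) (testG n p₂ c d) x with hT
  set W := d ^ (s / q) with hW
  have hW0 : 0 < W := by positivity
  have hWq : W ^ q = d ^ s := by
    rw [hW, ← Real.rpow_mul hd.le]; congr 1; field_simp
  have hRq : (r ^ (-(2 * κ))) ^ q = r ^ (-(n + s)) := by
    rw [← Real.rpow_mul hr0.le]; congr 1; rw [hs]; ring
  have hRq1 : (r ^ (-(2 * κ) - 1)) ^ q = r ^ (-(n + (s + q))) := by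
    rw [← Real.rpow_mul hr0.le]; congr 1; rw [hs]; ring
  have hB0 := abs_nonneg B
  have hosc : osc n b c d ≤ 1 := ho c d hd
  have hosc0 : 0 ≤ osc n b c d := by
    unfold osc
    rw [setAverage_eq]
    have : 0 ≤ ∫ x in cube n c d, |b x - cubeAvg n b c d| := integral_nonneg fun _ => abs_nonneg _
    exact smul_nonneg (by positivity) this
  have hR0 : 0 < r ^ (-(2 * κ)) := by positivity
  have hF0 : 0 ≤ F := le_trans (by positivity) hF1
  have hdr : d * r ^ (-(2 * κ) - 1) ≤ r ^ (-(2 * κ)) := by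
    rw [Real.rpow_sub_one hr0.ne', mul_div_assoc', div_le_iff₀ hr0, mul_comm]
    gcongr
    nlinarith
  constructor
  · have hT1 : |T| ≤ (c₂ + c₃) * (1 + |B|) * (r ^ (-(2 * κ)) * W) := by
      have a1 : |T| ≤ F + |B| * |H| := by
        rw [e, ← abs_mul]
        have := abs_sub F (B * H)
        rwa [abs_of_nonneg hF0] at this
      have a2 : F ≤ c₂ * (r ^ (-(2 * κ)) * W) := by
        refine hF2.trans ?_
        have : 0 ≤ c₂ * r ^ (-(2 * κ)) * W := by positivity
        nlinarith
      have a3 : |H| ≤ c₃ * (r ^ (-(2 * κ)) * W) := by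
        refine hH.trans ?_
        have : c₃ * W * (d * r ^ (-(2 * κ) - 1)) ≤ c₃ * W * r ^ (-(2 * κ)) := by gcongr
        nlinarith
      have a4 := mul_le_mul_of_nonneg_left a3 hB0
      have a5 : 0 ≤ c₂ * |B| * (r ^ (-(2 * κ)) * W) := by positivity
      have a6 : 0 ≤ c₃ * (r ^ (-(2 * κ)) * W) := by positivity
      nlinarith
    calc |T| ^ q ≤ ((c₂ + c₃) * (1 + |B|) * (r ^ (-(2 * κ)) * W)) ^ q :=
          Real.rpow_le_rpow (abs_nonneg _) hT1 hq0.le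
      _ = (c₂ + c₃) ^ q * (1 + |B|) ^ q * (r ^ (-(n + s)) * d ^ s) := by
          rw [Real.mul_rpow (by positivity) (by positivity),
            Real.mul_rpow (by positivity) (by positivity),
            Real.mul_rpow (by positivity) (by positivity), hRq, hWq]
      _ ≤ (c₂ + c₃) ^ q * (1 + |B|) ^ q *
            (((γ * d) ^ (-(s - s / 2)) * r ^ (-(n + s / 2))) * d ^ s) := by
          gcongr
          exact rpow_split hγd hx.le (by linarith)
      _ = _ := by
          rw [Jint, Real.mul_rpow hγ0.le hd.le, show s - s / 2 = s / 2 by ring]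
          have : d ^ s = d ^ (s / 2) * d ^ (s / 2) := by rw [← Real.rpow_add hd]; congr 1; ring
          rw [this, Real.rpow_neg hd.le]
          have : d ^ (s / 2) ≠ 0 := by positivity
          field_simp
          rfl
  · intro ε hε hεo
    have hlow : c₁ * ε * (W * r ^ (-(2 * κ))) ≤ |T| + |B| * |H| := by
      have a1 : F ≤ |T| + |B| * |H| := by
        rw [← abs_mul]
        have : F = T + B * H := by rw [e]; ring
        rw [this]
        exact (le_abs_self _).trans (abs_add_le _ _)
      refine le_trans ?_ (hF1.trans a1)
      have : c₁ * r ^ (-(2 * κ)) * W * ε ≤ c₁ * r ^ (-(2 * κ)) * W * osc n b c d := by gcongr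
      nlinarith
    have hBH : (|B| * |H|) ^ q ≤
        c₃ ^ q * (d ^ (q / 2) * γ ^ (-(s + q / 2))) * Jint n q (q / 2) b c d x := by
      calc (|B| * |H|) ^ q ≤ ((1 + |B|) * (c₃ * d * r ^ (-(2 * κ) - 1) * W)) ^ q := by
            apply Real.rpow_le_rpow (by positivity) _ hq0.le
            gcongr
            linarith
        _ = (1 + |B|) ^ q * (c₃ ^ q * d ^ q * r ^ (-(n + (s + q))) * d ^ s) := by
            rw [Real.mul_rpow (by positivity) (by positivity),
              Real.mul_rpow (by positivity) (by positivity),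
              Real.mul_rpow (by positivity) (by positivity),
              Real.mul_rpow (by positivity) (by positivity), hRq1, hWq]
        _ ≤ (1 + |B|) ^ q * (c₃ ^ q * d ^ q *
              ((γ * d) ^ (-(s + q - q / 2)) * r ^ (-(n + q / 2))) * d ^ s) := by
            gcongr
            exact rpow_split hγd hx.le (by linarith)
        _ = _ := by
            rw [Jint, Real.mul_rpow hγ0.le hd.le, show s + q - q / 2 = s + q / 2 by ring]
            have : d ^ q * d ^ s * d ^ (-(s + q / 2)) = d ^ (q / 2) := by
              rw [← Real.rpow_add hd, ← Real.rpow_add hd]; congr 1; ring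
            rw [← this]
            ring
    calc (c₁ * ε) ^ q * (d ^ s * r ^ (-(n + s))) = (c₁ * ε * (W * r ^ (-(2 * κ)))) ^ q := by
          rw [Real.mul_rpow (x := c₁ * ε) (y := W * r ^ (-(2 * κ))) (by positivity) (by positivity),
            Real.mul_rpow (x := W) (by positivity) (by positivity), hRq, hWq]
      _ ≤ (|T| + |B| * |H|) ^ q := Real.rpow_le_rpow (by positivity) hlow hq0.le
      _ ≤ 2 ^ q * (|T| ^ q + (|B| * |H|) ^ q) :=
          rpow_add_le (abs_nonneg _) (by positivity) hq0.le
      _ ≤ 2 ^ q * (|T| ^ q +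
            c₃ ^ q * (d ^ (q / 2) * γ ^ (-(s + q / 2))) * Jint n q (q / 2) b c d x) := by
          gcongr
      _ = _ := by ring

lemma exists_large (A t e M : ℝ) (he : 0 < e) (ht : 0 < t) :
    ∃ γ : ℝ, M < γ ∧ A * γ ^ (-e) ≤ t := by
  have h1 : Tendsto (fun γ : ℝ => A * γ ^ (-e)) atTop (𝓝 0) := by
    simpa using (tendsto_rpow_neg_atTop he).const_mul A
  obtain ⟨γ, h2, h3⟩ := ((eventually_gt_atTop M).and (h1.eventually (ge_mem_nhds ht))).exists
  exact ⟨γ, h2, h3⟩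

end Final

/-- (Annulus estimates (10) and (11).) There exist `γ₂ > γ₁ > 2` and
`γ₃ > 0`, depending only on `p₁, p₂, n, α, q, ε`, such that for every real-valued `b` with
`‖b‖_{BMO} = 1` and every cube `Q_j` (center `y_j`, side `d_j`) with `⨍_{Q_j}|b-b_{Q_j}| ≥ ε`,
`(∫_{γ₁d_j<|x-y_j|<γ₂d_j} |[b,I_α]₁(f_j,g_j)|^q)^{1/q} ≥ γ₃` and
`(∫_{|x-y_j|>γ₂d_j} |[b,I_α]₁(f_j,g_j)|^q)^{1/q} ≤ γ₃/4`. -/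
theorem statement15 (n : ℕ) (hn : 0 < n) (p₁ p₂ q α : ℝ)
    (hp₁ : 1 < p₁) (hp₂ : 1 < p₂)
    (hα₀ : 0 < α) (hα₂ : α < 2 * n)
    (hαp : α / n < 1 / p₁ + 1 / p₂) (hsum : 1 / p₁ + 1 / p₂ < 2)
    (hq : 1 / q = 1 / p₁ + 1 / p₂ - α / n) (hq' : 1 < q)
    (ε : ℝ) (hε : 0 < ε) :
    ∃ γ₁ γ₂ γ₃ : ℝ, 2 < γ₁ ∧ γ₁ < γ₂ ∧ 0 < γ₃ ∧
      ∀ b : Rn n → ℝ, LocallyIntegrable b volume → bmoNorm n b = 1 →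
        ∀ (yj : Rn n) (dj : ℝ), 0 < dj → ε ≤ osc n b yj dj →
          ENNReal.ofReal γ₃ ≤
            (∫⁻ x in {x : Rn n | γ₁ * dj < ‖x - yj‖ ∧ ‖x - yj‖ < γ₂ * dj},
                ENNReal.ofReal
                  (|commI n α b (testF n p₁ b yj dj) (testG n p₂ yj dj) x| ^ q)) ^ (1 / q) ∧
          (∫⁻ x in {x : Rn n | γ₂ * dj < ‖x - yj‖},
              ENNReal.ofReal
                (|commI n α b (testF n p₁ b yj dj) (testG n p₂ yj dj) x| ^ q)) ^ (1 / q)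
            ≤ ENNReal.ofReal (γ₃ / 4) := by
  have hn1 : (1:ℝ) ≤ n := by exact_mod_cast hn
  have hq0 : 0 < q := by linarith
  obtain ⟨κ, hκ⟩ : ∃ κ : ℝ, κ = n - α / 2 := ⟨_, rfl⟩
  have hκ0 : 0 < κ := by rw [hκ]; linarith
  obtain ⟨s, hs⟩ : ∃ s : ℝ, s = 2 * κ * q - n := ⟨_, rfl⟩
  have hs0 : 0 < s := by
    have h1 : (1 / q) * (n * q) < (2 - α / n) * (n * q) := by
      apply mul_lt_mul_of_pos_right _ (by positivity)
      rw [hq]; linarith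
    have h2 : (1 / q) * (n * q) = n := by field_simp
    have h3 : (2 - α / n) * (n * q) = 2 * κ * q := by rw [hκ]; field_simp
    rw [h2, h3] at h1
    linarith
  obtain ⟨c₁, c₂, c₃, hc₁, hc₂, hc₃, hpt⟩ := comm_pt n hn p₁ p₂ q α κ s hq0 hκ hκ0 hs hs0 hq
  obtain ⟨C₁, hC₁, hJ₁⟩ := J_lemma n q (s / 2) hq0 (by positivity)
  obtain ⟨C₂, hC₂, hJ₂⟩ := J_lemma n q (q / 2) hq0 (by positivity)
  obtain ⟨ω, hω⟩ : ∃ ω : ℝ, ω = (volume (Metric.ball (0 : Rn n) 1)).toReal := ⟨_, rfl⟩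
  have hω0 : 0 < ω := by
    rw [hω]
    exact ENNReal.toReal_pos (Metric.measure_ball_pos _ _ one_pos).ne' measure_ball_lt_top.ne
  have hωE : volume (Metric.ball (0 : Rn n) 1) = ENNReal.ofReal ω := by
    rw [hω, ENNReal.ofReal_toReal measure_ball_lt_top.ne]
  obtain ⟨AL, hAL⟩ : ∃ AL : ℝ, AL = (c₁ * ε) ^ q * 2 ^ (-(n + s)) * ω := ⟨_, rfl⟩
  have hAL0 : 0 < AL := by rw [hAL]; positivity
  obtain ⟨γ₁, hγ₁, hγ₁'⟩ := exists_large (c₃ * C₂) (AL / 2) (q / 2) (2 * n + 2) (by positivity)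
    (by positivity)
  have hγ₁0 : 0 < γ₁ := by linarith
  obtain ⟨Γ, hΓ⟩ : ∃ Γ : ℝ, Γ = 2 ^ (-q) * (AL * γ₁ ^ (-s) / 2) := ⟨_, rfl⟩
  have hΓ0 : 0 < Γ := by rw [hΓ]; positivity
  obtain ⟨γ₂, hγ₂, hγ₂'⟩ := exists_large (c₂ * C₁) (Γ * 4 ^ (-q)) (s / 2) (2 * γ₁) (by positivity)
    (by positivity)
  have hγ₂0 : 0 < γ₂ := by linarith
  refine ⟨γ₁, γ₂, Γ ^ (1 / q), by linarith, by linarith, by positivity, ?_⟩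
  intro b hb hbmo c d hd hε'
  have ho := osc_le_one hbmo
  have hrm : Measurable fun x : Rn n => ‖x - c‖ := (measurable_id.sub_const c).norm
  constructor
  · rw [← ENNReal.ofReal_rpow_of_nonneg hΓ0.le (by positivity)]
    refine ENNReal.rpow_le_rpow ?_ (by positivity)
    set S := {x : Rn n | γ₁ * d < ‖x - c‖ ∧ ‖x - c‖ < 2 * (γ₁ * d)} with hS
    have hSm : MeasurableSet S :=
      (measurableSet_lt measurable_const hrm).inter (measurableSet_lt hrm measurable_const)
    have hSsub : S ⊆ {x : Rn n | γ₁ * d < ‖x - c‖ ∧ ‖x - c‖ < γ₂ * d} := by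
      intro x hx
      exact ⟨hx.1, hx.2.trans (by nlinarith)⟩
    refine le_trans ?_ (lintegral_mono_set hSsub)
    set T := fun x => ENNReal.ofReal
      (|commI n α b (testF n p₁ b c d) (testG n p₂ c d) x| ^ q) with hT
    have hγd : 0 < γ₁ * d := by positivity
    set a := AL * γ₁ ^ (-s) with ha
    have ha0 : 0 < a := by positivity
    -- lower bound
    have hlow : ENNReal.ofReal a ≤ ENNReal.ofReal (2 ^ q) * (∫⁻ x in S, T x) +
        ENNReal.ofReal (a / 2) := by
      calc ENNReal.ofReal a
          = ENNReal.ofReal ((c₁ * ε) ^ q * (d ^ s * (2 * (γ₁ * d)) ^ (-(n + s)))) *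
              (ENNReal.ofReal ((γ₁ * d) ^ n) * volume (Metric.ball (0 : Rn n) 1)) := by
            rw [hωE, ← ENNReal.ofReal_mul (by positivity), ← ENNReal.ofReal_mul (by positivity)]
            congr 1
            rw [ha, hAL, Real.mul_rpow (by norm_num) hγd.le, ← Real.rpow_natCast (γ₁ * d) n]
            have e1 : (γ₁ * d) ^ (-((n:ℝ) + s)) * (γ₁ * d) ^ (n:ℝ) = γ₁ ^ (-s) * d ^ (-s) := by
              rw [← Real.rpow_add hγd, ← Real.mul_rpow hγ₁0.le hd.le]; congr 1; ring
            have e2 : d ^ s * d ^ (-s) = 1 := by rw [← Real.rpow_add hd]; simp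
            calc _ = (c₁ * ε) ^ q * 2 ^ (-((n:ℝ) + s)) * ω * (γ₁ ^ (-s) * (d ^ s * d ^ (-s))) := by
                  rw [e2]; ring
              _ = (c₁ * ε) ^ q * 2 ^ (-((n:ℝ) + s)) * ω * d ^ s * (γ₁ ^ (-s) * d ^ (-s)) := by ring
              _ = _ := by rw [← e1]; ring
        _ ≤ ENNReal.ofReal ((c₁ * ε) ^ q * (d ^ s * (2 * (γ₁ * d)) ^ (-(n + s)))) * volume S := by
            gcongr
            exact ann_vol hn c hγd
        _ = ∫⁻ x in S, ENNReal.ofReal ((c₁ * ε) ^ q * (d ^ s * (2 * (γ₁ * d)) ^ (-(n + s)))) := by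
            rw [setLIntegral_const]
        _ ≤ ∫⁻ x in S, (ENNReal.ofReal (2 ^ q) * T x +
              ENNReal.ofReal (c₃ * (d ^ (q / 2) * γ₁ ^ (-(s + q / 2)))) *
                ENNReal.ofReal (Jint n q (q / 2) b c d x)) := by
            refine setLIntegral_mono' hSm fun x hx => ?_
            have hJ0 := Jint_nonneg n q (q / 2) b c d x
            rw [hT, ← ENNReal.ofReal_mul (by positivity), ← ENNReal.ofReal_mul (by positivity),
              ← ENNReal.ofReal_add (by positivity) (by positivity)]
            apply ENNReal.ofReal_le_ofReal
            refine le_trans ?_ ((hpt b hb ho c d γ₁ hd (by linarith) x hx.1).2 ε hε hε')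
            gcongr ?_ * (?_ * ?_)
            exact Real.rpow_le_rpow_of_nonpos (hγd.trans hx.1) hx.2.le (by linarith)
        _ = ENNReal.ofReal (2 ^ q) * (∫⁻ x in S, T x) +
              ENNReal.ofReal (c₃ * (d ^ (q / 2) * γ₁ ^ (-(s + q / 2)))) *
                ∫⁻ x in S, ENNReal.ofReal (Jint n q (q / 2) b c d x) := by
            rw [lintegral_add_right' _ ((Jint_aem q (q / 2) hb c d).restrict.ennreal_ofReal.const_mul _),
              lintegral_const_mul' _ _ ENNReal.ofReal_ne_top,
              lintegral_const_mul' _ _ ENNReal.ofReal_ne_top]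
        _ ≤ ENNReal.ofReal (2 ^ q) * (∫⁻ x in S, T x) +
              ENNReal.ofReal (c₃ * (d ^ (q / 2) * γ₁ ^ (-(s + q / 2)))) *
                ENNReal.ofReal (C₂ * d ^ (-(q / 2))) := by
            gcongr
            refine le_trans (lintegral_mono_set ?_) (hJ₂ b hb ho c d hd)
            intro x hx
            have := hx.1
            show d < ‖x - c‖
            nlinarith
        _ ≤ _ := by
            gcongr
            rw [← ENNReal.ofReal_mul (by positivity)]
            apply ENNReal.ofReal_le_ofReal
            have e1 : d ^ (q / 2) * d ^ (-(q / 2)) = 1 := by rw [← Real.rpow_add hd]; simp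
            have e2 : γ₁ ^ (-(s + q / 2)) = γ₁ ^ (-s) * γ₁ ^ (-(q / 2)) := by
              rw [← Real.rpow_add hγ₁0]; congr 1; ring
            calc _ = c₃ * C₂ * γ₁ ^ (-(q / 2)) * γ₁ ^ (-s) * (d ^ (q / 2) * d ^ (-(q / 2))) := by
                  rw [e2]; ring
              _ = c₃ * C₂ * γ₁ ^ (-(q / 2)) * γ₁ ^ (-s) := by rw [e1, mul_one]
              _ ≤ AL / 2 * γ₁ ^ (-s) := by gcongr
              _ = a / 2 := by rw [ha]; ring
    have hlow2 : ENNReal.ofReal (a / 2) ≤ ENNReal.ofReal (2 ^ q) * (∫⁻ x in S, T x) := by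
      have : ENNReal.ofReal a = ENNReal.ofReal (a / 2) + ENNReal.ofReal (a / 2) := by
        rw [← ENNReal.ofReal_add (by positivity) (by positivity)]; congr 1; ring
      rw [this] at hlow
      exact ENNReal.le_of_add_le_add_right ENNReal.ofReal_ne_top hlow
    rw [hΓ, ENNReal.ofReal_mul (by positivity)]
    calc _ ≤ ENNReal.ofReal (2 ^ (-q)) * (ENNReal.ofReal (2 ^ q) * (∫⁻ x in S, T x)) := by gcongr
      _ = _ := by
        rw [← mul_assoc, ← ENNReal.ofReal_mul (by positivity), ← Real.rpow_add (by norm_num)]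
        simp
  · have hg : ENNReal.ofReal (Γ ^ (1 / q) / 4) = (ENNReal.ofReal (Γ * 4 ^ (-q))) ^ (1 / q) := by
      rw [ENNReal.ofReal_rpow_of_nonneg (by positivity) (by positivity)]
      congr 1
      rw [Real.mul_rpow hΓ0.le (by positivity), ← Real.rpow_mul (by norm_num),
        show -q * (1 / q) = -1 by field_simp, Real.rpow_neg_one]
      rfl
    rw [hg]
    refine ENNReal.rpow_le_rpow ?_ (by positivity)
    calc _ ≤ ∫⁻ x in {x : Rn n | γ₂ * d < ‖x - c‖},
          ENNReal.ofReal (c₂ * (d ^ (s / 2) * γ₂ ^ (-(s / 2)))) *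
            ENNReal.ofReal (Jint n q (s / 2) b c d x) := by
          refine setLIntegral_mono' (measurableSet_lt measurable_const hrm) fun x hx => ?_
          rw [← ENNReal.ofReal_mul (by positivity)]
          exact ENNReal.ofReal_le_ofReal (hpt b hb ho c d γ₂ hd (by linarith) x hx).1
      _ = ENNReal.ofReal (c₂ * (d ^ (s / 2) * γ₂ ^ (-(s / 2)))) *
            ∫⁻ x in {x : Rn n | γ₂ * d < ‖x - c‖}, ENNReal.ofReal (Jint n q (s / 2) b c d x) :=
          lintegral_const_mul' _ _ ENNReal.ofReal_ne_top
      _ ≤ ENNReal.ofReal (c₂ * (d ^ (s / 2) * γ₂ ^ (-(s / 2)))) *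
            ENNReal.ofReal (C₁ * d ^ (-(s / 2))) := by
          gcongr
          refine le_trans (lintegral_mono_set ?_) (hJ₁ b hb ho c d hd)
          intro x hx
          have hx' : γ₂ * d < ‖x - c‖ := hx
          show d < ‖x - c‖
          nlinarith
      _ ≤ _ := by
          rw [← ENNReal.ofReal_mul (by positivity)]
          apply ENNReal.ofReal_le_ofReal
          have e1 : d ^ (s / 2) * d ^ (-(s / 2)) = 1 := by rw [← Real.rpow_add hd]; simp
          calc _ = c₂ * C₁ * γ₂ ^ (-(s / 2)) * (d ^ (s / 2) * d ^ (-(s / 2))) := by ring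
            _ = c₂ * C₁ * γ₂ ^ (-(s / 2)) := by rw [e1, mul_one]
            _ ≤ _ := hγ₂'
end
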